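/- arXiv:1303.0502 — 4 statements merged into one kernel-verified Lean document; each statement's English description precedes it below -/
import Mathlib

section
/- Let n ≥ 1 and let f ∈ A_n with f(z) ≠ 0 for all z ∈ U \ {0} and f'(z) ≠ 0 for all z ∈ U. Let 0 < α ≤ 1/2 be real and let β, γ be complex numbers with γ ≠ 0 and Re(β/γ) < n. If |(β − γ)·(z f'(z)/f(z)) + γ·(1 + z f''(z)/f'(z))| < (1/2)|nγ − β| for all z ∈ U, then |f(z)/(z f'(z)) − 1/(2α)| < 1/(2α) for all z ∈ U \ {0}; in particular f ∈ S*(α). -/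
open Complex Metric

set_option maxHeartbeats 2000000 in
lemma poly_key (Q T a μ : ℝ) (hQ : 0 < Q) (hT : 0 < T) (ha : 0 ≤ a)
    (hc : (a + Q + T)^2 = 4*Q*(1 - T - 2*Q)) (hμ : 0 ≤ μ) (hμT : T*μ ≤ a + Q) :
    4*Q*(4*Q + (T+3*Q)*μ) * ((a+Q)^2 + 2*a*T
        + 2*μ*((a+Q)^2 + 2*Q^2 + Q*T + 2*a*T - Q) + μ^2*(1-2*T-2*Q))
      ≤ (a+Q)^2*(4*Q+(T+3*Q)*(1+μ))*(4*Q+(T+3*Q)*(1+2*μ)+(1+μ)*μ) := by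
  obtain ⟨A, hA⟩ : ∃ A, A = a + Q := ⟨_, rfl⟩
  obtain ⟨g, hg⟩ : ∃ g, g = T + 3*Q := ⟨_, rfl⟩
  obtain ⟨c0, hc0⟩ : ∃ c, c = 4*Q + g := ⟨_, rfl⟩
  obtain ⟨Z, hZ⟩ : ∃ Z, Z = A^2 + 2*Q^2 + Q*T + 2*a*T - Q := ⟨_, rfl⟩
  obtain ⟨e0, he0⟩ : ∃ e, e = A^2*c0^2 - 16*Q^2*(A^2+2*a*T) := ⟨_, rfl⟩
  obtain ⟨e1, he1⟩ : ∃ e, e = A^2*c0*(3*g+1)-4*Q*g*(A^2+2*a*T)-32*Q^2*Z := ⟨_, rfl⟩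
  obtain ⟨e2, he2⟩ : ∃ e, e = A^2*(c0+2*g^2+g)-16*Q^2*(1-2*T-2*Q)-8*Q*g*Z := ⟨_, rfl⟩
  obtain ⟨e3, he3⟩ : ∃ e, e = g*T*(2*A+T-4*Q) := ⟨_, rfl⟩
  have h4 : (a+Q+T)^2 + 4*Q*T + 8*Q^2 = 4*Q := by linarith
  have hA0 : 0 < A := by rw [hA]; linarith
  have p0 : 0 ≤ e0 := by
    have : e0 = Q^2*T^2 + 33*Q^4 + 2*a*Q*T^2 + 66*a*Q^3 + a^2*T^2 + 33*a^2*Q^2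
        + 2*Q*T*(Q-a)^2 + 12*Q^3*T+12*a^2*Q*T := by
      subst he0 hc0 hg hA; ring
    rw [this]; positivity
  have p1 : 0 ≤ 3*e0*T + e1*A := by
    have h : 4*Q*(3*e0*T + e1*A) =
          13*Q^3*T^3 +225*Q^4*T^2 +615*Q^5*T +171*Q^6 +27*a*Q^2*T^3 +29*a*Q^3*T^2 +1049*a*Q^4*T
          +527*a*Q^5 +15*a^2*Q*T^3 +217*a^2*Q^2*T^2 +622*a^2*Q^3*T +562*a^2*Q^4 +1*a^3*T^3
          +31*a^3*Q*T^2 +206*a^3*Q^2*T +234*a^3*Q^3 +2*a^4*T^2 +19*a^4*Q*T +35*a^4*Q^2 +1*a^5*T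
          +7*a^5*Q := by
      subst he3 he2 he1 he0 hZ hc0 hg hA
      linear_combination (-(1*Q^3*T +39*Q^4 +3*a*Q^2*T +53*a*Q^3 +3*a^2*Q*T +21*a^2*Q^2 +1*a^3*T +7*a^3*Q))*h4
    have h' : 0 ≤ 4*Q*(3*e0*T + e1*A) := by
      rw [h]; positivity
    exact nonneg_of_mul_nonneg_right h' (by positivity)
  have p2 : 0 ≤ 3*e0*T^2 + 2*e1*A*T + e2*A^2 := by
    have h : 16*Q^2*(3*e0*T^2 + 2*e1*A*T + e2*A^2) =
          40*Q^4*T^4 +1104*Q^5*T^3 +3648*Q^6*T^2 +2160*Q^7*T +216*Q^8 +88*a*Q^3*T^4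
          +328*a*Q^4*T^3 +5720*a*Q^5*T^2 +5688*a*Q^6*T +912*a*Q^7 +56*a^2*Q^2*T^4
          +952*a^2*Q^3*T^3 +3504*a^2*Q^4*T^2 +5480*a^2*Q^5*T +1512*a^2*Q^6 +8*a^3*Q*T^4
          +216*a^3*Q^2*T^3 +1648*a^3*Q^3*T^2 +2640*a^3*Q^4*T +1248*a^3*Q^5 +24*a^4*Q*T^3
          +240*a^4*Q^2*T^2 +800*a^4*Q^3*T +552*a^4*Q^4 +24*a^5*Q*T^2 +120*a^5*Q^2*T +144*a^5*Q^3
          +8*a^6*Q*T +24*a^6*Q^2 := by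
      subst he3 he2 he1 he0 hZ hc0 hg hA
      linear_combination (-(4*Q*(2*Q^3*T^2 +120*Q^4*T +66*Q^5 +6*a*Q^2*T^2 +194*a*Q^3*T +152*a*Q^4 +6*a^2*Q*T^2
          +94*a^2*Q^2*T +116*a^2*Q^3 +2*a^3*T^2 +22*a^3*Q*T +40*a^3*Q^2 +2*a^4*T +10*a^4*Q)
          + (-16*Q^4 -32*a*Q^3 -16*a^2*Q^2)*(4*Q+((a+Q+T)^2 + 4*Q*T + 8*Q^2))))*h4
    have h' : 0 ≤ 16*Q^2*(3*e0*T^2 + 2*e1*A*T + e2*A^2) := by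
      rw [h]; positivity
    exact nonneg_of_mul_nonneg_right h' (by positivity)
  have p3 : 0 ≤ e0*T^3+e1*A*T^2+e2*A^2*T-e3*A^3 := by
    have h : 16*Q^2*(e0*T^3+e1*A*T^2+e2*A^2*T-e3*A^3) =
          400*Q^5*T^4 +1680*Q^6*T^3 +1584*Q^7*T^2 +432*Q^8*T +48*a*Q^4*T^4 +2384*a*Q^5*T^3
          +3728*a*Q^6*T^2 +1392*a*Q^7*T +176*a^2*Q^3*T^4 +1152*a^2*Q^4*T^3 +2960*a^2*Q^5*T^2
          +1632*a^2*Q^6*T +16*a^3*Q^2*T^4 +464*a^3*Q^3*T^3 +1072*a^3*Q^4*T^2 +864*a^3*Q^5*T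
          +16*a^4*Q^2*T^3 +256*a^4*Q^3*T^2 +240*a^4*Q^4*T +48*a^5*Q^3*T := by
      subst he3 he2 he1 he0 hZ hc0 hg hA
      linear_combination (-(4*Q*(80*Q^4*T^2 +72*Q^5*T +136*a*Q^3*T^2 +164*a*Q^4*T +64*a^2*Q^2*T^2 +116*a^2*Q^3*T
          +8*a^3*Q*T^2 +28*a^3*Q^2*T +4*a^4*Q*T)
          + (-16*Q^4*T -32*a*Q^3*T -16*a^2*Q^2*T)*(4*Q+((a+Q+T)^2 + 4*Q*T + 8*Q^2))))*h4
    have h' : 0 ≤ 16*Q^2*(e0*T^3+e1*A*T^2+e2*A^2*T-e3*A^3) := by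
      rw [h]; positivity
    exact nonneg_of_mul_nonneg_right h' (by positivity)
  have key : 0 ≤ e0 + e1*μ + e2*μ^2 - e3*μ^3 := by
    have hν : 0 ≤ A - T*μ := by rw [hA]; linarith
    have : 0 ≤ A^3*T^3*(e0 + e1*μ + e2*μ^2 - e3*μ^3) := by
      have h : A^3*T^3*(e0 + e1*μ + e2*μ^2 - e3*μ^3)
        = T^3*e0*(A-T*μ)^3 + T^2*(3*e0*T + e1*A)*(A-T*μ)^2*(T*μ)
          + T*(3*e0*T^2 + 2*e1*A*T + e2*A^2)*(A-T*μ)*(T*μ)^2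
          + (e0*T^3+e1*A*T^2+e2*A^2*T-e3*A^3)*(T*μ)^3 := by ring
      rw [h]; positivity
    exact nonneg_of_mul_nonneg_right this (by positivity)
  have e3' : g*T*(2*A+T-4*Q) = g*(4*Q*(1-2*T-2*Q) - A^2) := by
    rw [hA]; linear_combination g*hc
  subst he3
  rw [e3'] at key
  subst he0 he1 he2 hZ hc0 hg hA
  linarith [key]

set_option maxHeartbeats 1000000 in
lemma real_facts (x y k d m X T A : ℝ) (hk0 : 0 < k) (hk : 4*k^2 = (1-x)^2+y^2)
    (hd0 : 0 ≤ d) (hd : d^2 = (1+x)^2+y^2) (hb : x^2+y^2 < k^2)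
    (hX0 : 0 ≤ X) (hX : X^2 = k^2*((m+x)^2+y^2))
    (hm : 1 ≤ m)
    (hT : T = k^2 - (x^2+y^2)) (hA : A = k*d - T) :
    0 < T ∧ 0 < d ∧ 0 < A ∧ 0 < 1 + x ∧ k*d ≤ X := by
  have hT0 : 0 < T := by rw [hT]; linarith
  have hdp : 0 < d := by
    rcases hd0.lt_or_eq with h | h
    · exact h
    · exfalso
      rw [← h] at hd
      have h1 : (1+x)^2 = 0 := by nlinarith [sq_nonneg (1+x), sq_nonneg y]
      have h2 : x = -1 := by
        have := pow_eq_zero_iff (n := 2) (by norm_num) |>.1 h1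
        linarith
      subst h2
      nlinarith
  obtain ⟨Q, hQ⟩ : ∃ Q, Q = d^2/4 := ⟨_, rfl⟩
  have hQ0 : 0 < Q := by rw [hQ]; positivity
  have hg : 1 + x = T + 3*Q := by rw [hT, hQ]; linarith
  have hkd : (k*d)^2 = 4*Q*(1-T-2*Q) := by
    have : (k*d)^2 = k^2*d^2 := by ring
    rw [this, hQ, hT]
    have h2 : k^2 = ((1-x)^2+y^2)/4 := by linarith
    rw [h2, hd]; ring
  have hsq : (k*d)^2 = (T+Q)^2 + y^2 := by
    rw [hkd]
    have h2 : k^2 = ((1-x)^2+y^2)/4 := by linarith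
    rw [hT, hQ, h2, hd]; ring
  have hle : T + Q ≤ k*d := by
    apply le_of_sq_le_sq _ (by positivity)
    nlinarith [sq_nonneg y]
  obtain ⟨a, haA⟩ : ∃ a, a = A - Q := ⟨_, rfl⟩
  have ha : 0 ≤ a := by rw [haA, hA]; linarith
  have hA0 : 0 < A := by linarith
  have hAT : k*d = a + Q + T := by rw [haA, hA]; ring
  have hy2 : y^2 = a*(a+2*Q+2*T) := by
    rw [hAT] at hsq; linarith
  have hx : x = T + 3*Q - 1 := by linarith
  have hg0 : 0 < 1 + x := by rw [hg]; positivity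
  have hXkd : k*d ≤ X := by
    apply le_of_sq_le_sq _ hX0
    rw [hX, mul_pow, hd]
    have : (1+x)^2 ≤ (m+x)^2 := pow_le_pow_left₀ hg0.le (by linarith) 2
    have hk2 : 0 ≤ k^2 := by positivity
    exact mul_le_mul_of_nonneg_left (by linarith) hk2
  exact ⟨hT0, hdp, hA0, hg0, hXkd⟩

set_option maxHeartbeats 1000000 in
lemma real_core1 (x y k d m X Y T A : ℝ) (hk0 : 0 < k) (hk : 4*k^2 = (1-x)^2+y^2)
    (hd0 : 0 ≤ d) (hd : d^2 = (1+x)^2+y^2) (hb : x^2+y^2 < k^2)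
    (hX0 : 0 ≤ X) (hX : X^2 = k^2*((m+x)^2+y^2))
    (hY0 : 0 ≤ Y) (hY : Y^2 = (k^2+m*x)^2+m^2*y^2) (hm : 1 ≤ m)
    (hT : T = k^2 - (x^2+y^2)) (hA : A = k*d - T) (hmT : T*(m-1) ≤ A) :
    0 < T ∧ 0 < d ∧ 0 < A ∧ k*d ≤ X ∧ k*d*(m-1)*Y ≤ A*(m*X - k*d) := by
  have hT0 : 0 < T := by rw [hT]; linarith
  have hdp : 0 < d := by
    rcases hd0.lt_or_eq with h | h
    · exact h
    · exfalso
      rw [← h] at hd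
      have h1 : (1+x)^2 = 0 := by nlinarith [sq_nonneg (1+x), sq_nonneg y]
      have h2 : x = -1 := by
        have := pow_eq_zero_iff (n := 2) (by norm_num) |>.1 h1
        linarith
      subst h2
      nlinarith
  obtain ⟨Q, hQ⟩ : ∃ Q, Q = d^2/4 := ⟨_, rfl⟩
  have hQ0 : 0 < Q := by rw [hQ]; positivity
  have hg : 1 + x = T + 3*Q := by rw [hT, hQ]; linarith
  have hkd : (k*d)^2 = 4*Q*(1-T-2*Q) := by
    have : (k*d)^2 = k^2*d^2 := by ring
    rw [this, hQ, hT]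
    have h2 : k^2 = ((1-x)^2+y^2)/4 := by linarith
    rw [h2, hd]; ring
  have hsq : (k*d)^2 = (T+Q)^2 + y^2 := by
    rw [hkd]
    have h2 : k^2 = ((1-x)^2+y^2)/4 := by linarith
    rw [hT, hQ, h2, hd]; ring
  have hle : T + Q ≤ k*d := by
    apply le_of_sq_le_sq _ (by positivity)
    nlinarith [sq_nonneg y]
  obtain ⟨a, haA⟩ : ∃ a, a = A - Q := ⟨_, rfl⟩
  have ha : 0 ≤ a := by rw [haA, hA]; linarith
  have hA0 : 0 < A := by linarith
  have hAT : k*d = a + Q + T := by rw [haA, hA]; ring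
  have hy2 : y^2 = a*(a+2*Q+2*T) := by
    rw [hAT] at hsq; linarith
  have hx : x = T + 3*Q - 1 := by linarith
  have hg0 : 0 < 1 + x := by rw [hg]; positivity
  have hXkd : k*d ≤ X := by
    apply le_of_sq_le_sq _ hX0
    rw [hX, mul_pow, hd]
    have : (1+x)^2 ≤ (m+x)^2 := pow_le_pow_left₀ hg0.le (by linarith) 2
    have hk2 : 0 ≤ k^2 := by positivity
    exact mul_le_mul_of_nonneg_left (by linarith) hk2
  refine ⟨hT0, hdp, hA0, hXkd, ?_⟩
  obtain ⟨μ, hμ⟩ : ∃ μ, m = 1 + μ := ⟨m - 1, by ring⟩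
  subst hμ
  have hμ0 : 0 ≤ μ := by linarith
  have key := poly_key Q T a μ hQ0 hT0 ha (by rw [← hAT]; exact hkd) hμ0 (by
    have : A = a + Q := by rw [haA]; ring
    rw [← this]; linarith)
  have hk2 : k^2 = T + x^2 + y^2 := by rw [hT]; ring
  have h4Q : 4*Q = (T+3*Q)^2 + a*(a+2*Q+2*T) := by
    rw [← hy2, ← hg]; linarith
  have hYe : Y^2 = (a+Q)^2 + 2*a*T
        + 2*μ*((a+Q)^2 + 2*Q^2 + Q*T + 2*a*T - Q) + μ^2*(1-2*T-2*Q) := by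
    have e1 : k^2 + x = Q := by rw [hQ]; linarith
    have e2 : k^2 + (1+μ)*x = Q + μ*x := by rw [← e1]; ring
    rw [hY, e2, hy2, hx]
    linear_combination (-μ^2)*h4Q
  rw [← hYe] at key
  have hAe : a + Q = A := by rw [haA]; ring
  have hgg : T + 3*Q = 1 + x := hg.symm
  have h4 : 4*Q = d^2 := by rw [hQ]; ring
  rw [hAe, hgg, h4] at key
  obtain ⟨g, hgd⟩ : ∃ g, g = 1 + x := ⟨_, rfl⟩
  rw [← hgd] at key
  have hg0' : 0 < g := by rw [hgd]; exact hg0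
  have hl : 0 < d^2 + g*μ := by positivity
  have hXg : X^2 = k^2*(d^2+2*g*μ+μ^2) := by rw [hX, hd, hgd]; ring
  have amgm : k^2*μ^2*(d^2+g*(1+μ))*(d^2+g*(1+2*μ)+(1+μ)*μ)
      ≤ ((1+μ)*X - k*d)^2*(d^2+g*μ) := by
    have h1 : 0 ≤ (1+μ)*(X*d - k*(d^2+g*μ))^2 := by positivity
    have h2 : ((1+μ)*X - k*d)^2*(d^2+g*μ) =
      (1+μ)*(X*d - k*(d^2+g*μ))^2
        + ((1+μ)^2*X^2*(d^2+g*μ) + k^2*d^2*(d^2+g*μ) - (1+μ)*(X^2*d^2+k^2*(d^2+g*μ)^2)) := by ring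
    have h3 : (1+μ)^2*X^2*(d^2+g*μ) + k^2*d^2*(d^2+g*μ) - (1+μ)*(X^2*d^2+k^2*(d^2+g*μ)^2)
      = k^2*μ^2*(d^2+g*(1+μ))*(d^2+g*(1+2*μ)+(1+μ)*μ) := by
      rw [hXg]; ring
    rw [h2, h3]; linarith
  have hΛ : 0 ≤ (1+μ)*X - k*d := by
    have := mul_nonneg hμ0 hX0
    linarith
  apply le_of_sq_le_sq _ (by positivity)
  have fin : (k*d*(1+μ-1)*Y)^2 * (d^2+g*μ) ≤ (A*((1+μ)*X - k*d))^2 * (d^2+g*μ) := by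
    have h1 := mul_le_mul_of_nonneg_left key (show 0 ≤ k^2*μ^2 by positivity)
    have h2 := mul_le_mul_of_nonneg_left amgm (show 0 ≤ A^2 by positivity)
    linarith [h1, h2]
  exact le_of_mul_le_mul_right fin hl

lemma real_mono (x y M ν : ℝ) (hν : 0 ≤ ν) (hM : 0 < M) (hMx : 0 ≤ M + x)
    (hW : 0 ≤ M^2 - (x^2+y^2)) :
    (M^2 - (x^2+y^2))^2 * ((M+ν+x)^2+y^2) ≤ ((M+ν)^2 - (x^2+y^2))^2 * ((M+x)^2+y^2) := by
  obtain ⟨W, hWd⟩ : ∃ W, W = M^2 - (x^2+y^2) := ⟨_, rfl⟩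
  obtain ⟨V, hVd⟩ : ∃ V, V = (M+x)^2+y^2 := ⟨_, rfl⟩
  obtain ⟨s, hs⟩ : ∃ s, s = M + x := ⟨_, rfl⟩
  have e1 : (M+ν)^2 - (x^2+y^2) = W + 2*M*ν + ν^2 := by rw [hWd]; ring
  have e2 : (M+ν+x)^2+y^2 = V + 2*s*ν + ν^2 := by rw [hVd, hs]; ring
  have e3 : 2*M*s = W + V := by rw [hWd, hVd, hs]; ring
  have hVs : s^2 ≤ V := by rw [hVd, hs]; nlinarith [sq_nonneg y]
  rw [← hWd] at hW
  rw [← hs] at hMx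
  rw [e1, e2, ← hWd, ← hVd]
  have hV : 0 ≤ V := le_trans (sq_nonneg _) hVs
  have h1 : 0 ≤ 2*M*V - s*W := by
    have : s*W = 2*M*s^2 - s*V := by linear_combination -s*e3
    rw [this]
    have := mul_le_mul_of_nonneg_left hVs hM.le
    have := mul_nonneg hMx hV
    linarith
  have h2 : 0 ≤ 4*M^2*V - W^2 := by
    have a1 : W ≤ 2*M*s := by linarith
    have a2 : W^2 ≤ (2*M*s)^2 := pow_le_pow_left₀ hW a1 2
    have a3 := mul_le_mul_of_nonneg_left hVs (show 0 ≤ 4*M^2 by positivity)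
    linarith
  have h3 : (W + 2*M*ν + ν^2)^2*V - W^2*(V+2*s*ν+ν^2)
     = ν*(2*W*(2*M*V - s*W)) + ν^2*(4*M^2*V - W^2) + V*(2*W*ν^2 + 4*M*ν^3+ν^4) := by ring
  have : 0 ≤ (W + 2*M*ν + ν^2)^2*V - W^2*(V+2*s*ν+ν^2) := by
    rw [h3]; positivity
  linarith

lemma real_core2 (x y k d m X Y T A R : ℝ) (hk0 : 0 < k) (hk : 4*k^2 = (1-x)^2+y^2)
    (hd0 : 0 ≤ d) (hd : d^2 = (1+x)^2+y^2) (hb : x^2+y^2 < k^2)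
    (hX0 : 0 ≤ X) (hX : X^2 = k^2*((m+x)^2+y^2))
    (hY0 : 0 ≤ Y) (hY : Y^2 = (k^2+m*x)^2+m^2*y^2) (hm : 1 ≤ m)
    (hT : T = k^2 - (x^2+y^2)) (hA : A = k*d - T)
    (hR0 : 0 ≤ R) (hR1 : R ≤ 1) (hmR : k*d ≤ m*(k*d - A*R)) :
    k*d - A*R + R*Y ≤ X := by
  have hm0 : 0 < m := by linarith
  by_cases hmT : T*(m-1) ≤ A
  · obtain ⟨hT0, hdp, hA0, hXkd, main⟩ :=
      real_core1 x y k d m X Y T A hk0 hk hd0 hd hb hX0 hX hY0 hY hm hT hA hmT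
    by_cases hYA : Y ≤ A
    · nlinarith
    · push Not at hYA
      have h1 : A*m*R ≤ k*d*(m-1) := by linarith
      have h2 : A*m*R*(Y-A) ≤ k*d*(m-1)*(Y-A) := mul_le_mul_of_nonneg_right h1 (by linarith)
      have h3 : A*m*(k*d - A*R + R*Y) ≤ A*m*X := by nlinarith
      exact le_of_mul_le_mul_left h3 (by positivity)
  · push Not at hmT
    obtain ⟨hT0, hdp, hA0, hx1, hXkd⟩ :=
      real_facts x y k d m X T A hk0 hk hd0 hd hb hX0 hX hm hT hA
    obtain ⟨M, hM⟩ : ∃ M, M = k*d/T := ⟨_, rfl⟩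
    have hMT : M*T = k*d := by rw [hM]; field_simp
    have hM1 : 1 ≤ M := by
      rw [hM, le_div_iff₀ hT0]; linarith
    have hMm : M ≤ m := by
      rw [hM, div_le_iff₀ hT0]; linarith
    obtain ⟨XM, hXM⟩ : ∃ XM, XM = k*Real.sqrt ((M+x)^2+y^2) := ⟨_, rfl⟩
    obtain ⟨YM, hYM⟩ : ∃ YM, YM = Real.sqrt ((k^2+M*x)^2+M^2*y^2) := ⟨_, rfl⟩
    have hXM0 : 0 ≤ XM := by rw [hXM]; positivity
    have hYM0 : 0 ≤ YM := by rw [hYM]; positivity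
    have hXM2 : XM^2 = k^2*((M+x)^2+y^2) := by
      rw [hXM, mul_pow, Real.sq_sqrt (by positivity)]
    have hYM2 : YM^2 = (k^2+M*x)^2+M^2*y^2 := by
      rw [hYM, Real.sq_sqrt (by positivity)]
    obtain ⟨-, -, -, hXMkd, mainM⟩ :=
      real_core1 x y k d M XM YM T A hk0 hk hd0 hd hb hXM0 hXM2 hYM0 hYM2 hM1 hT hA (by linarith)
    have hTM : T ≤ XM := by linarith
    have hYXM : YM ≤ XM - T := by
      have e1 : k*d*(M-1)*YM = (M*A)*YM := by
        have : T*(M-1) = A := by linarith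
        rw [← hMT, ← this]; ring
      have e2 : A*(M*XM-k*d) = (M*A)*(XM - T) := by rw [← hMT]; ring
      rw [e1, e2] at mainM
      exact le_of_mul_le_mul_left mainM (by positivity)
    have h2XM : 2*XM ≤ M^2 - (x^2+y^2) := by
      have a1 : YM^2 ≤ (XM-T)^2 := pow_le_pow_left₀ hYM0 hYXM 2
      have a2 : XM^2 - YM^2 = T*(M^2-k^2) := by rw [hXM2, hYM2, hT]; ring
      have a3 : T*(2*XM) ≤ T*(M^2 - (x^2+y^2)) := by
        have : T*(M^2 - (x^2+y^2)) = T*(M^2-k^2) + T^2 := by rw [hT]; ring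
        rw [this, ← a2]; linarith
      exact le_of_mul_le_mul_left a3 hT0
    have hMx : 0 < M + x := by linarith
    have mono := real_mono x y M (m-M) (by linarith) (by linarith) hMx.le (by linarith)
    have e5 : M + (m-M) = m := by ring
    rw [e5] at mono
    have hVM : 0 < (M+x)^2+y^2 := by positivity
    have hmB : 0 ≤ m^2 - (x^2+y^2) := by
      have := pow_le_pow_left₀ (by linarith : 0 ≤ M) hMm 2
      linarith
    have h2X : 2*X ≤ m^2 - (x^2+y^2) := by
      apply le_of_sq_le_sq _ hmB
      have b1 : (2*XM)^2 ≤ (M^2-(x^2+y^2))^2 := pow_le_pow_left₀ (by positivity) h2XM 2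
      have b2 : (2*X)^2*((M+x)^2+y^2) = (2*XM)^2*((m+x)^2+y^2) := by
        rw [mul_pow, mul_pow, hX, hXM2]; ring
      have b3 : (2*X)^2*((M+x)^2+y^2) ≤ (m^2 - (x^2+y^2))^2*((M+x)^2+y^2) := by
        rw [b2]
        exact le_trans (mul_le_mul_of_nonneg_right b1 (by positivity)) mono
      exact le_of_mul_le_mul_right b3 hVM
    have hTX : T ≤ X := by linarith
    have hYX : Y ≤ X - T := by
      apply le_of_sq_le_sq _ (by linarith)
      have a2 : X^2 - Y^2 = T*(m^2-k^2) := by rw [hX, hY, hT]; ring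
      have a3 := mul_le_mul_of_nonneg_left h2X hT0.le
      have : T*(m^2 - (x^2+y^2)) = T*(m^2-k^2) + T^2 := by rw [hT]; ring
      rw [this, ← a2] at a3
      linarith
    have f1 := mul_le_mul_of_nonneg_left hYX hR0
    have f2 := mul_le_mul_of_nonneg_left hXkd (show 0 ≤ 1 - R by linarith)
    rw [hA]
    linarith

lemma complex_facts (b : ℂ) (k : ℝ) (hk : k = ‖1 - b‖/2) (hb : ‖b‖ < k) :
    0 < k^2 - ‖b‖^2 ∧ 0 < ‖1+b‖ ∧ 0 < k*‖1+b‖ - (k^2 - ‖b‖^2) := by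
  have hk0 : 0 < k := lt_of_le_of_lt (norm_nonneg _) hb
  have hb2 : ‖b‖^2 = b.re^2 + b.im^2 := by rw [Complex.sq_norm, Complex.normSq_apply]; ring
  have hk2 : 4*k^2 = (1-b.re)^2 + b.im^2 := by
    have : 4*k^2 = ‖1-b‖^2 := by rw [hk]; ring
    rw [this, Complex.sq_norm, Complex.normSq_apply]; simp; ring
  have hd2 : ‖1+b‖^2 = (1+b.re)^2 + b.im^2 := by
    rw [Complex.sq_norm, Complex.normSq_apply]; simp; ring
  have hbk : b.re^2 + b.im^2 < k^2 := by
    rw [← hb2]; exact pow_lt_pow_left₀ hb (norm_nonneg _) (by norm_num)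
  obtain ⟨h1, h2, h3, -, -⟩ := real_facts b.re b.im k ‖1+b‖ 1 (k*‖1+b‖) (k^2 - ‖b‖^2)
    (k*‖1+b‖ - (k^2 - ‖b‖^2)) hk0 hk2 (norm_nonneg _) hd2 hbk (by positivity)
    (by rw [mul_pow, hd2]) le_rfl (by rw [hb2]) rfl
  exact ⟨h1, h2, h3⟩

lemma complex_core (b : ℂ) (k m R : ℝ) (hk : k = ‖1 - b‖/2) (hb : ‖b‖ < k) (hm : 1 ≤ m)
    (hR0 : 0 ≤ R) (hR1 : R ≤ 1)
    (hmR : k*‖1+b‖ ≤ m*(k*‖1+b‖ - (k*‖1+b‖ - (k^2 - ‖b‖^2))*R)) :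
    k*‖1+b‖ - (k*‖1+b‖ - (k^2 - ‖b‖^2))*R + R*‖(k:ℂ)^2 + m*b‖ ≤ k*‖(m:ℂ)+b‖ := by
  have hk0 : 0 < k := lt_of_le_of_lt (norm_nonneg _) hb
  have hb2 : ‖b‖^2 = b.re^2 + b.im^2 := by rw [Complex.sq_norm, Complex.normSq_apply]; ring
  have hk2 : 4*k^2 = (1-b.re)^2 + b.im^2 := by
    have : 4*k^2 = ‖1-b‖^2 := by rw [hk]; ring
    rw [this, Complex.sq_norm, Complex.normSq_apply]; simp; ring
  have hd2 : ‖1+b‖^2 = (1+b.re)^2 + b.im^2 := by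
    rw [Complex.sq_norm, Complex.normSq_apply]; simp; ring
  have hbk : b.re^2 + b.im^2 < k^2 := by
    rw [← hb2]; exact pow_lt_pow_left₀ hb (norm_nonneg _) (by norm_num)
  refine real_core2 b.re b.im k ‖1+b‖ m (k*‖(m:ℂ)+b‖) (‖(k:ℂ)^2 + m*b‖) (k^2 - ‖b‖^2)
    (k*‖1+b‖ - (k^2 - ‖b‖^2)) R hk0 hk2 (norm_nonneg _) hd2 hbk (by positivity)
    ?_ (norm_nonneg _) ?_ hm (by rw [hb2]) rfl hR0 hR1 hmR
  · rw [mul_pow, Complex.sq_norm, Complex.normSq_apply]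
    simp only [add_re, ofReal_re, add_im, ofReal_im]; ring
  · rw [Complex.sq_norm, Complex.normSq_apply, ← Complex.ofReal_pow]
    simp only [add_re, ofReal_re, re_ofReal_mul, add_im, ofReal_im, im_ofReal_mul]; ring

lemma schwarz_pow (n : ℕ) (h : ℂ → ℂ) (hh : DifferentiableOn ℂ h (ball 0 1))
    (hb : ∀ z ∈ ball (0:ℂ) 1, ‖z^n * h z‖ ≤ 1) : ∀ z ∈ ball (0:ℂ) 1, ‖h z‖ ≤ 1 := by
  intro z hz
  rw [mem_ball_zero_iff] at hz
  have key : ∀ r ∈ Set.Ioo ‖z‖ 1, r^n * ‖h z‖ ≤ 1 := by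
    intro r hr
    have hr0 : 0 < r := lt_of_le_of_lt (norm_nonneg _) hr.1
    have hsub : closedBall (0:ℂ) r ⊆ ball 0 1 := closedBall_subset_ball hr.2
    have hd : DiffContOnCl ℂ h (ball 0 r) := by
      apply DifferentiableOn.diffContOnCl
      rw [closure_ball _ hr0.ne']
      exact hh.mono hsub
    have := Complex.norm_le_of_forall_mem_frontier_norm_le (U := ball (0:ℂ) r) (C := 1/r^n)
      isBounded_ball hd (by
        intro y hy
        rw [frontier_ball _ hr0.ne', mem_sphere_zero_iff_norm] at hy
        have := hb y (by rw [mem_ball_zero_iff, hy]; exact hr.2)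
        rw [norm_mul, norm_pow, hy] at this
        rw [le_div_iff₀ (by positivity)]; linarith)
      (z := z) (by rw [closure_ball _ hr0.ne']; rw [mem_closedBall_zero_iff]; exact hr.1.le)
    rw [le_div_iff₀ (by positivity)] at this
    linarith
  have ht : Filter.Tendsto (fun r : ℝ => r^n * ‖h z‖) (nhdsWithin 1 (Set.Iio 1)) (nhds (1^n*‖h z‖)) := by
    apply Filter.Tendsto.mono_left _ nhdsWithin_le_nhds
    exact (Continuous.tendsto (by fun_prop) 1)
  have := le_of_tendsto ht (Filter.eventually_of_mem (Ioo_mem_nhdsLT hz) key)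
  simpa using this

lemma norm_key (b P D : ℂ) (k : ℝ) (hb : ‖b‖ ≤ k) (hD : ‖D‖ ≤ k*‖P‖) :
    k*‖b*P - D‖ ≤ ‖(k:ℂ)^2*P - (starRingEnd ℂ) b * D‖ := by
  have hk0 : 0 ≤ k := le_trans (norm_nonneg _) hb
  apply le_of_sq_le_sq _ (norm_nonneg _)
  have h1 : ‖D‖^2 ≤ k^2*‖P‖^2 := by rw [← mul_pow]; exact pow_le_pow_left₀ (norm_nonneg _) hD 2
  have h2 : ‖b‖^2 ≤ k^2 := pow_le_pow_left₀ (norm_nonneg _) hb 2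
  have h3 : ‖(k:ℂ)^2*P - (starRingEnd ℂ) b * D‖^2 - (k*‖b*P - D‖)^2
      = (k^2 - ‖b‖^2)*(k^2*‖P‖^2 - ‖D‖^2) := by
    rw [mul_pow, Complex.sq_norm, Complex.sq_norm, Complex.sq_norm, Complex.sq_norm, Complex.sq_norm,
      ← Complex.ofReal_pow]
    simp only [Complex.normSq_apply, sub_re, sub_im, ofReal_re, ofReal_im, mul_re, mul_im,
      conj_re, conj_im]
    ring
  have := mul_nonneg (sub_nonneg.2 h2) (sub_nonneg.2 h1)
  linarith

lemma schwarz_pick (n : ℕ) (v : ℂ → ℂ) (hv : DifferentiableOn ℂ v (ball 0 1))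
    (b : ℂ) (k : ℝ) (hb : ‖b‖ < k)
    (hP : ∀ z ∈ ball (0:ℂ) 1, 1 + z^n * v z ≠ 0)
    (hD : ∀ z ∈ ball (0:ℂ) 1, ‖b - z^n*(v z + z*deriv v z/n)‖ ≤ k*‖1 + z^n * v z‖) :
    ∀ z ∈ ball (0:ℂ) 1, k*‖(1+b)*v z + z*deriv v z/n‖ ≤
      ‖(k:ℂ)^2*(1 + z^n * v z) - (starRingEnd ℂ) b * (b - z^n*(v z + z*deriv v z/n))‖ := by
  have hk0 : 0 < k := lt_of_le_of_lt (norm_nonneg _) hb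
  have hden : ∀ z ∈ ball (0:ℂ) 1, (k:ℂ)^2*(1 + z^n * v z)
      - (starRingEnd ℂ) b * (b - z^n*(v z + z*deriv v z/n)) ≠ 0 := by
    intro z hz h0
    have h1 := congrArg norm (sub_eq_zero.1 h0)
    rw [norm_mul, norm_mul, norm_pow, RCLike.norm_conj, Complex.norm_real, Real.norm_of_nonneg hk0.le] at h1
    have hPp : 0 < ‖1 + z^n * v z‖ := norm_pos_iff.2 (hP z hz)
    have h2 := mul_le_mul_of_nonneg_left (hD z hz) (norm_nonneg b)
    have h3 := mul_lt_mul_of_pos_right hb (mul_pos hk0 hPp)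
    rw [← h1] at h2
    nlinarith
  have hv' : DifferentiableOn ℂ (deriv v) (ball 0 1) := hv.deriv isOpen_ball
  have hs := schwarz_pow n (fun z => ((k:ℂ)*((1+b)*v z + z*deriv v z/n)) /
    ((k:ℂ)^2*(1 + z^n * v z) - (starRingEnd ℂ) b * (b - z^n*(v z + z*deriv v z/n))))
    (by
      apply DifferentiableOn.div _ _ hden <;> fun_prop)
    (by
      intro z hz
      have e : z^n * ((k:ℂ)*((1+b)*v z + z*deriv v z/n)) =
        (k:ℂ)*(b*(1 + z^n * v z) - (b - z^n*(v z + z*deriv v z/n))) := by ring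
      rw [← mul_div_assoc, e, norm_div, div_le_one (norm_pos_iff.2 (hden z hz)), norm_mul,
        Complex.norm_real, Real.norm_of_nonneg hk0.le]
      exact norm_key b _ _ k hb.le (hD z hz))
  intro z hz
  have := hs z hz
  rw [norm_div, div_le_one (norm_pos_iff.2 (hden z hz)), norm_mul,
        Complex.norm_real, Real.norm_of_nonneg hk0.le] at this
  exact this

lemma b_lt_k (n : ℕ) (hn : 1 ≤ n) (v : ℂ → ℂ) (hv : DifferentiableOn ℂ v (ball 0 1))
    (b : ℂ) (k : ℝ)
    (hP : ∀ z ∈ ball (0:ℂ) 1, 1 + z^n * v z ≠ 0)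
    (hD : ∀ z ∈ ball (0:ℂ) 1, z ≠ 0 → ‖b - z^n*(v z + z*deriv v z/n)‖ < k*‖1 + z^n * v z‖) :
    ‖b‖ < k := by
  by_contra hcon
  push Not at hcon
  have hn0 : n ≠ 0 := by omega
  have hv' : DifferentiableOn ℂ (deriv v) (ball 0 1) := hv.deriv isOpen_ball
  let g : ℂ → ℂ := fun z => (b - z^n*(v z + z*deriv v z/n)) / (1 + z^n * v z)
  have hg : DifferentiableOn ℂ g (ball 0 1) := by
    apply DifferentiableOn.div _ _ hP <;> fun_prop
  have g0 : g 0 = b := by simp [g, hn0]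
  have hlt : ∀ z ∈ ball (0:ℂ) 1, z ≠ 0 → ‖g z‖ < k := by
    intro z hz h
    simp only [g]
    rw [norm_div, div_lt_iff₀ (norm_pos_iff.2 (hP z hz))]
    exact hD z hz h
  have hball : ball (0:ℂ) 1 ∈ nhds (0:ℂ) := ball_mem_nhds _ one_pos
  have hd : ∀ᶠ z in nhds (0:ℂ), DifferentiableAt ℂ g z := by
    filter_upwards [isOpen_ball.mem_nhds (mem_ball_self one_pos)] with z hz
    exact (hg z hz).differentiableAt (isOpen_ball.mem_nhds hz)
  have hmax : IsLocalMax (norm ∘ g) 0 := by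
    filter_upwards [hball] with z hz
    by_cases h : z = 0
    · rw [h]
    · simp only [Function.comp, g0]
      exact (hlt z hz h).le.trans hcon
  have := Complex.norm_eventually_eq_of_isLocalMax hd hmax
  obtain ⟨ε, hε, h⟩ := Metric.eventually_nhds_iff_ball.1 this
  obtain ⟨r, hr⟩ : ∃ r, r = min ε 1 / 2 := ⟨_, rfl⟩
  have hr0 : 0 < r := by rw [hr]; positivity
  have hr1 : r < 1 := by rw [hr]; linarith [min_le_right ε 1]
  have hrε : r < ε := by rw [hr]; linarith [min_le_left ε 1, lt_min hε one_pos]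
  have nr : ‖(r:ℂ)‖ = r := by rw [Complex.norm_real, Real.norm_of_nonneg hr0.le]
  have h1 := h (r:ℂ) (by rw [mem_ball_zero_iff, nr]; exact hrε)
  have h2 := hlt (r:ℂ) (by rw [mem_ball_zero_iff, nr]; exact hr1) (by exact_mod_cast hr0.ne')
  rw [h1, g0] at h2
  linarith

lemma right_deriv_nonpos (ψ : ℝ → ℝ) (c : ℝ) (h : HasDerivAt ψ c 0)
    (hmax : ∀ t, 0 < t → ψ t ≤ ψ 0) : c ≤ 0 := by
  have := h.tendsto_slope_zero_right
  apply le_of_tendsto this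
  filter_upwards [self_mem_nhdsWithin] with t ht
  have ht' : 0 < t := ht
  rw [smul_eq_mul, zero_add]
  exact mul_nonpos_of_nonneg_of_nonpos (by positivity) (by linarith [hmax t ht'])

lemma contact (n : ℕ) (hn : 1 ≤ n) (v : ℂ → ℂ) (hv : DifferentiableOn ℂ v (ball 0 1))
    (κ A T : ℝ) (hA : 0 < A) (hT : 0 < T) (hκ : κ = A + T)
    (z1 : ℂ) (hz1 : z1 ∈ ball (0:ℂ) 1) (hw : 1 ≤ ‖z1^n * v z1‖) :
    ∃ z ∈ ball (0:ℂ) 1, ∃ m : ℝ, 1 ≤ m ∧ z * deriv v z / n = ((m:ℂ) - 1) * v z ∧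
      T < ‖v z‖ * (κ - A*‖z‖^n) ∧ κ ≤ m * (κ - A*‖z‖^n) := by
  have hn0 : n ≠ 0 := by omega
  have hz1n : ‖z1‖ < 1 := by simpa using hz1
  have hz10 : z1 ≠ 0 := by
    rintro rfl
    simp [hn0] at hw
    linarith
  have hsub : closedBall (0:ℂ) ‖z1‖ ⊆ ball 0 1 := closedBall_subset_ball hz1n
  have hcont : ContinuousOn (fun z => ‖v z‖ * (κ - A*‖z‖^n)) (closedBall (0:ℂ) ‖z1‖) := by
    have := (hv.continuousOn.mono hsub)
    fun_prop
  obtain ⟨z, hz, hmax⟩ := (isCompact_closedBall (0:ℂ) ‖z1‖).exists_isMaxOn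
    ⟨0, by simp⟩ hcont
  have hzn : ‖z‖ ≤ ‖z1‖ := by simpa using hz
  have hzb : z ∈ ball (0:ℂ) 1 := hsub hz
  have hz1T : T < ‖v z1‖ * (κ - A*‖z1‖^n) := by
    rw [norm_mul, norm_pow] at hw
    have hρ0 : 0 < ‖z1‖^n := by positivity
    have hρ1 : ‖z1‖^n < 1 := pow_lt_one₀ (norm_nonneg _) hz1n hn0
    have h1 : A * ‖z1‖^n < κ - T * ‖z1‖^n := by
      rw [hκ]; nlinarith
    have h2 : 0 < κ - A * ‖z1‖^n := by nlinarith
    have h3 := mul_le_mul_of_nonneg_right hw h2.le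
    have h4 : T * ‖z1‖^n < (‖v z1‖ * (κ - A*‖z1‖^n)) * ‖z1‖^n := by linarith
    exact lt_of_mul_lt_mul_right h4 hρ0.le
  have hzT : T < ‖v z‖ * (κ - A*‖z‖^n) := lt_of_lt_of_le hz1T (hmax (by simp))
  have hR1 : ‖z‖^n ≤ 1 := pow_le_one₀ (norm_nonneg _) (by linarith)
  obtain ⟨R, hR⟩ : ∃ R, R = ‖z‖^n := ⟨_, rfl⟩
  have hR0 : 0 ≤ R := by rw [hR]; positivity
  rw [← hR] at hzT hR1
  have hs0 : 0 < κ - A*R := by rw [hκ]; nlinarith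
  have hV0 : 0 < ‖v z‖ := by
    by_contra hc
    have : ‖v z‖ = 0 := le_antisymm (not_lt.1 hc) (norm_nonneg _)
    rw [this] at hzT; linarith
  have hvz : HasDerivAt v (deriv v z) z :=
    ((hv z hzb).differentiableAt (isOpen_ball.mem_nhds hzb)).hasDerivAt
  obtain ⟨c, hc⟩ : ∃ c, c = (starRingEnd ℂ) (v z) * (z * deriv v z) := ⟨_, rfl⟩
  have claim : ∀ ζ : ℂ, ζ.re ≤ 0 → (c*ζ).re * (κ - A*R) ≤ ‖v z‖^2*(A*R*(n*ζ.re)) := by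
    intro ζ hζ
    have d1 : HasDerivAt (fun s : ℂ => z * Complex.exp (s*ζ)) (z*ζ) 0 := by
      have : HasDerivAt (fun s : ℂ => s*ζ) (1*ζ) 0 := (hasDerivAt_id (0:ℂ)).mul_const ζ
      have := (this.cexp).const_mul z
      simpa using this
    have d2 : HasDerivAt (fun s : ℂ => v (z * Complex.exp (s*ζ))) (deriv v z * (z*ζ)) 0 := by
      apply HasDerivAt.comp (h₂ := v) (h := fun s : ℂ => z * Complex.exp (s*ζ)) 0 _ d1
      simpa using hvz
    have d3 : HasDerivAt (fun t : ℝ => v (z * Complex.exp (t*ζ))) (deriv v z * (z*ζ)) 0 := by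
      have := HasDerivAt.comp_ofReal (z := 0) (by simpa using d2)
      simpa using this
    have d4 := d3.norm_sq
    have d5 : HasDerivAt (fun t : ℝ => (κ - A*(R*Real.exp (t*(n*ζ.re))))^2)
        (2*(κ - A*R)*(-(A*(R*(n*ζ.re))))) 0 := by
      have e1 : HasDerivAt (fun t : ℝ => t*(n*ζ.re)) (1*(n*ζ.re)) 0 :=
        (hasDerivAt_id (0:ℝ)).mul_const _
      have := ((((e1.exp).const_mul R).const_mul A).const_sub κ).pow 2
      exact this.congr_deriv (by simp)
    have d6 := d4.mul d5
    have hle := right_deriv_nonpos _ _ d6 (by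
      intro t ht
      have hnorm : ‖z * Complex.exp (t*ζ)‖ = ‖z‖ * Real.exp (t*ζ.re) := by
        rw [norm_mul, Complex.norm_exp]; simp
      have hexp : Real.exp (t*ζ.re) ≤ 1 := by
        rw [Real.exp_le_one_iff]; exact mul_nonpos_of_nonneg_of_nonpos ht.le hζ
      have hin : z * Complex.exp (t*ζ) ∈ closedBall (0:ℂ) ‖z1‖ := by
        rw [mem_closedBall_zero_iff, hnorm]
        exact (mul_le_of_le_one_right (norm_nonneg _) hexp).trans hzn
      have h1 := hmax hin
      simp only [Set.mem_ofPred_eq] at h1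
      have hpow : ‖z * Complex.exp (t*ζ)‖^n = R * Real.exp (t*(n*ζ.re)) := by
        rw [hnorm, mul_pow, ← hR, ← Real.exp_nat_mul]; ring_nf
      rw [hpow, ← hR] at h1
      have hexp2 : Real.exp (t*(n*ζ.re)) ≤ 1 := by
        rw [Real.exp_le_one_iff]
        exact mul_nonpos_of_nonneg_of_nonpos ht.le
          (mul_nonpos_of_nonneg_of_nonpos (by positivity) hζ)
      have h2 : 0 ≤ κ - A*(R*Real.exp (t*(n*ζ.re))) := by
        have : R*Real.exp (t*(n*ζ.re)) ≤ R := mul_le_of_le_one_right hR0 hexp2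
        nlinarith
      have h3 := pow_le_pow_left₀ (by positivity) h1 2
      rw [mul_pow, mul_pow] at h3
      simpa using h3)
    simp only [Complex.inner, ofReal_zero, zero_mul, Complex.exp_zero, Real.exp_zero, mul_one] at hle
    have e2 : deriv v z * (z*ζ) * (starRingEnd ℂ) (v z) = c * ζ := by rw [hc]; ring
    rw [e2] at hle
    have h5 : (2*(κ - A*R)) * ((c*ζ).re * (κ - A*R)) ≤ (2*(κ - A*R)) * (‖v z‖^2*(A*R*(n*ζ.re))) := by
      linarith
    exact le_of_mul_le_mul_left h5 (by positivity)
  have hI := claim I (by simp)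
  have hI' := claim (-I) (by simp)
  have h1' := claim (-1) (by simp)
  simp at hI hI' h1'
  have hcim : c.im = 0 := by
    have a1 : c.im * (κ - A*R) = 0 := le_antisymm (by linarith) (by linarith)
    rcases mul_eq_zero.1 a1 with h | h
    · exact h
    · linarith
  obtain ⟨μ, hμ⟩ : ∃ μ, μ = c.re / (n*‖v z‖^2) := ⟨_, rfl⟩
  have hnp : (0:ℝ) < n := by exact_mod_cast hn
  have hμc : μ * (n*‖v z‖^2) = c.re := by rw [hμ]; field_simp
  have hμA : A*R ≤ μ * (κ - A*R) := by
    have : (n*‖v z‖^2) * (A*R) ≤ (n*‖v z‖^2) * (μ*(κ - A*R)) := by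
      have : (n*‖v z‖^2) * (μ*(κ - A*R)) = c.re * (κ - A*R) := by rw [← hμc]; ring
      rw [this]; linarith
    exact le_of_mul_le_mul_left this (by positivity)
  have hμ0 : 0 ≤ μ := by
    have : 0 ≤ μ * (κ - A*R) := le_trans (by positivity) hμA
    exact nonneg_of_mul_nonneg_left this hs0
  refine ⟨z, hzb, 1 + μ, by linarith, ?_, by rw [← hR]; exact hzT, by rw [← hR]; linarith⟩
  have hcc : c = ((μ * (n*‖v z‖^2) : ℝ) : ℂ) := by
    apply Complex.ext
    · simp only [ofReal_re]; exact hμc.symm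
    · simp only [ofReal_im]; exact hcim
  have hVne : v z ≠ 0 := norm_pos_iff.1 hV0
  have hVc : (starRingEnd ℂ) (v z) ≠ 0 := by simpa using hVne
  have hnc : (n:ℂ) ≠ 0 := by exact_mod_cast hn0
  have hsq : ((‖v z‖^2 : ℝ):ℂ) = (starRingEnd ℂ) (v z) * v z := by
    rw [mul_comm, Complex.mul_conj, Complex.normSq_eq_norm_sq]
  have e3 : (starRingEnd ℂ) (v z) * (z * deriv v z) = (starRingEnd ℂ) (v z) * (n * μ * v z) := by
    rw [← hc, hcc, ofReal_mul, ofReal_mul, hsq]; push_cast; ring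
  have e4 := mul_left_cancel₀ hVc e3
  rw [e4]; push_cast; field_simp; ring

lemma main_analytic (n : ℕ) (hn : 1 ≤ n) (v : ℂ → ℂ) (hv : DifferentiableOn ℂ v (ball 0 1))
    (b : ℂ) (k : ℝ) (hk : k = ‖1 - b‖/2)
    (hP : ∀ z ∈ ball (0:ℂ) 1, 1 + z^n * v z ≠ 0)
    (hD : ∀ z ∈ ball (0:ℂ) 1, z ≠ 0 → ‖b - z^n*(v z + z*deriv v z/n)‖ < k*‖1 + z^n * v z‖) :
    ∀ z ∈ ball (0:ℂ) 1, ‖z^n * v z‖ < 1 := by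
  have hn0 : n ≠ 0 := by omega
  have hb := b_lt_k n hn v hv b k hP hD
  have hk0 : 0 < k := lt_of_le_of_lt (norm_nonneg _) hb
  have SP := schwarz_pick n v hv b k hb hP (by
    intro z hz
    by_cases h : z = 0
    · rw [h]; simp [hn0]; exact hb.le
    · exact (hD z hz h).le)
  obtain ⟨hT, hd, hA⟩ := complex_facts b k hk hb
  intro z1 hz1
  by_contra hcon
  push Not at hcon
  obtain ⟨z, hz, m, hm, hzv, hTv, hmκ⟩ := contact n hn v hv (k*‖1+b‖)
    (k*‖1+b‖ - (k^2 - ‖b‖^2)) (k^2 - ‖b‖^2) hA hT (by ring) z1 hz1 hcon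
  have hz1' : ‖z‖ < 1 := by simpa using hz
  have hR0 : 0 ≤ ‖z‖^n := by positivity
  have hR1 : ‖z‖^n ≤ 1 := pow_le_one₀ (norm_nonneg _) hz1'.le
  have core := complex_core b k m (‖z‖^n) hk hb hm hR0 hR1 hmκ
  have sp := SP z hz
  rw [hzv] at sp
  have e1 : (1+b)*v z + ((m:ℂ)-1)*v z = ((m:ℂ)+b)*v z := by ring
  have hbb : (starRingEnd ℂ) b * b = ((‖b‖^2 : ℝ) : ℂ) := by
    rw [mul_comm, Complex.mul_conj, Complex.normSq_eq_norm_sq]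
  have e2 : (k:ℂ)^2*(1 + z^n * v z) - (starRingEnd ℂ) b * (b - z^n*(v z + ((m:ℂ)-1)*v z))
      = ((k^2 - ‖b‖^2 : ℝ) : ℂ) + (starRingEnd ℂ) ((k:ℂ)^2 + m*b) * (z^n * v z) := by
    have : ((k^2 - ‖b‖^2 : ℝ) : ℂ) = (k:ℂ)^2 - (starRingEnd ℂ) b * b := by
      rw [hbb]; push_cast; ring
    rw [this]
    simp only [map_add, map_pow, map_mul, Complex.conj_ofReal]
    ring
  rw [e1, e2, norm_mul] at sp
  have sp2 := sp.trans (norm_add_le _ _)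
  rw [Complex.norm_real, Real.norm_of_nonneg hT.le, norm_mul, RCLike.norm_conj, norm_mul,
    norm_pow] at sp2
  have c2 := mul_le_mul_of_nonneg_right core (norm_nonneg (v z))
  linarith

lemma exists_factor (n : ℕ) (hn : 1 ≤ n) (f : ℂ → ℂ)
    (hf : DifferentiableOn ℂ f (ball (0 : ℂ) 1))
    (hf0 : f 0 = 0) (hf'0 : deriv f 0 = 1)
    (hcoef : ∀ k : ℕ, 2 ≤ k → k ≤ n → iteratedDeriv k f 0 = 0) :
    ∃ G : ℂ → ℂ, DifferentiableOn ℂ G (ball (0:ℂ) 1) ∧ ∀ z, f z = z + z^(n+1) * G z := by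
  have hfa : AnalyticAt ℂ f 0 := hf.analyticAt (ball_mem_nhds _ one_pos)
  obtain ⟨G, hG, hfG⟩ := hfa.exists_eq_sum_add_pow_mul (n+1)
  have hsum : ∀ z : ℂ, (∑ i ∈ Finset.range (n+1), (z ^ i / i.factorial) • iteratedDeriv i f 0) = z := by
    intro z
    rw [Finset.sum_eq_single 1]
    · simp [iteratedDeriv_one, hf'0]
    · intro i hi h1
      rw [Finset.mem_range] at hi
      rcases Nat.eq_zero_or_pos i with h | h
      · subst h; simp [hf0]
      · rw [hcoef i (by omega) (by omega), smul_zero]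
    · intro h
      exact absurd (Finset.mem_range.2 (by omega)) h
  have hfG' : ∀ z, f z = z + z^(n+1) * G z := by
    intro z
    have := hfG z
    rw [hsum] at this
    simpa using this
  refine ⟨G, ?_, hfG'⟩
  intro z hz
  by_cases h : z = 0
  · rw [h]; exact hG.differentiableAt.differentiableWithinAt
  · have hd : DifferentiableAt ℂ (fun z => (f z - z)/z^(n+1)) z := by
      have := (hf z hz).differentiableAt (isOpen_ball.mem_nhds hz)
      have hz0 : z^(n+1) ≠ 0 := pow_ne_zero _ h
      exact DifferentiableAt.fun_div (c := fun z => f z - z) (d := fun z => z^(n+1)) (by fun_prop) (by fun_prop) hz0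
    have he : G =ᶠ[nhds z] (fun z => (f z - z)/z^(n+1)) := by
      filter_upwards [isOpen_ne.mem_nhds h] with y hy
      rw [hfG' y]
      have : y^(n+1) ≠ 0 := pow_ne_zero _ hy
      field_simp
      ring
    exact (he.differentiableAt_iff.2 hd).differentiableWithinAt

lemma bound_w (n : ℕ) (hn : 1 ≤ n) (f : ℂ → ℂ)
    (hf : DifferentiableOn ℂ f (ball (0 : ℂ) 1))
    (hf0 : f 0 = 0) (hf'0 : deriv f 0 = 1)
    (hcoef : ∀ k : ℕ, 2 ≤ k → k ≤ n → iteratedDeriv k f 0 = 0)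
    (hfne : ∀ z ∈ ball (0 : ℂ) 1, z ≠ 0 → f z ≠ 0)
    (hf'ne : ∀ z ∈ ball (0 : ℂ) 1, deriv f z ≠ 0)
    (β γ : ℂ) (hγ : γ ≠ 0)
    (hbound : ∀ z ∈ ball (0 : ℂ) 1, z ≠ 0 →
      ‖(β - γ) * (z * deriv f z / f z)
          + γ * (1 + z * deriv (deriv f) z / deriv f z)‖
        < (1 / 2) * ‖(n : ℂ) * γ - β‖) :
    ∀ z ∈ ball (0 : ℂ) 1, z ≠ 0 → ‖f z / (z * deriv f z) - 1‖ < 1 := by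
  have hn0 : n ≠ 0 := by omega
  have hnc : (n:ℂ) ≠ 0 := by exact_mod_cast hn0
  obtain ⟨G, hG, hfG⟩ := exists_factor n hn f hf hf0 hf'0 hcoef
  have hG' : DifferentiableOn ℂ (deriv G) (ball 0 1) := hG.deriv isOpen_ball
  have hf' : DifferentiableOn ℂ (deriv f) (ball 0 1) := hf.deriv isOpen_ball
  have hdf : ∀ z ∈ ball (0:ℂ) 1, deriv f z = 1 + z^n*((n+1)*G z + z*deriv G z) := by
    intro z hz
    have hGz := ((hG z hz).differentiableAt (isOpen_ball.mem_nhds hz)).hasDerivAt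
    have h1 : HasDerivAt f (1 + (((n+1:ℕ):ℂ)*z^n * G z + z^(n+1)*deriv G z)) z := by
      have e : f = fun z => z + z^(n+1) * G z := funext hfG
      rw [e]
      exact (hasDerivAt_id z).add ((hasDerivAt_pow (n+1) z).mul hGz)
    rw [h1.deriv]; push_cast; ring
  obtain ⟨v, hv⟩ : ∃ v : ℂ → ℂ, v = fun z => -(n*G z + z*deriv G z)/deriv f z := ⟨_, rfl⟩
  have hvd : DifferentiableOn ℂ v (ball 0 1) := by
    rw [hv]
    apply DifferentiableOn.div _ hf' hf'ne
    fun_prop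
  have hPe : ∀ z ∈ ball (0:ℂ) 1, z ≠ 0 → 1 + z^n * v z = f z / (z * deriv f z) := by
    intro z hz h
    have h1 := hf'ne z hz
    have h2 : (1 + z^n * v z) * deriv f z = 1 + z^n * G z := by
      rw [hv]
      simp only
      field_simp
      rw [hdf z hz]; ring
    rw [eq_div_iff (mul_ne_zero h h1), hfG z]
    linear_combination z*h2
  have hP : ∀ z ∈ ball (0:ℂ) 1, 1 + z^n * v z ≠ 0 := by
    intro z hz
    by_cases h : z = 0
    · rw [h]; simp [hn0]
    · rw [hPe z hz h]
      exact div_ne_zero (hfne z hz h) (mul_ne_zero h (hf'ne z hz))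
  have main := main_analytic n hn v hvd (β/(γ*n)) _ rfl hP (by
    intro z hz h
    have hb := hbound z hz h
    have h1 := hf'ne z hz
    have h2 := hfne z hz h
    have hvz := ((hvd z hz).differentiableAt (isOpen_ball.mem_nhds hz)).hasDerivAt
    have hfz := ((hf z hz).differentiableAt (isOpen_ball.mem_nhds hz)).hasDerivAt
    have hfz' := ((hf' z hz).differentiableAt (isOpen_ball.mem_nhds hz)).hasDerivAt
    have d1 : HasDerivAt (fun z => 1 + z^n * v z) ((n:ℂ)*z^(n-1)*v z + z^n*deriv v z) z :=
      ((hasDerivAt_pow n z).mul hvz).const_add 1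
    have d2 : HasDerivAt (fun z => f z / (z * deriv f z))
        ((deriv f z * (z*deriv f z) - f z*(1*deriv f z + z*deriv (deriv f) z))/(z*deriv f z)^2) z :=
      hfz.div ((hasDerivAt_id z).mul hfz') (mul_ne_zero h h1)
    have d3 : HasDerivAt (fun z => 1 + z^n * v z)
        ((deriv f z * (z*deriv f z) - f z*(1*deriv f z + z*deriv (deriv f) z))/(z*deriv f z)^2) z := by
      apply d2.congr_of_eventuallyEq
      filter_upwards [isOpen_ne.mem_nhds h, isOpen_ball.mem_nhds hz] with y hy hyb
      exact hPe y hyb hy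
    have hu := d1.unique d3
    have hzn : z * z^(n-1) = z^n := by rw [← pow_succ']; congr 1; omega
    have e1 : (n:ℂ)*(z^n*(v z + z*deriv v z/n)) =
        z*((deriv f z * (z*deriv f z) - f z*(1*deriv f z + z*deriv (deriv f) z))/(z*deriv f z)^2) := by
      rw [← hu, ← hzn]; field_simp
    have e2 : γ*n*(β/(γ*n) - z^n*(v z + z*deriv v z/n)) =
        ((β - γ) * (z * deriv f z / f z) + γ * (1 + z * deriv (deriv f) z / deriv f z))
          * (1 + z^n * v z) := by
      have : γ*n*(β/(γ*n) - z^n*(v z + z*deriv v z/n))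
        = β - γ*((n:ℂ)*(z^n*(v z + z*deriv v z/n))) := by field_simp
      rw [this, e1, hPe z hz h]
      field_simp
      ring
    have e3 : (n:ℂ)*γ - β = γ*n*(1 - β/(γ*n)) := by field_simp
    rw [e3, norm_mul] at hb
    have e4 := congrArg norm e2
    rw [norm_mul, norm_mul _ (1 + z^n * v z)] at e4
    have hPp : 0 < ‖1 + z^n * v z‖ := norm_pos_iff.2 (hP z hz)
    have hgn : 0 < ‖γ*n‖ := norm_pos_iff.2 (mul_ne_zero hγ hnc)
    have h5 := mul_lt_mul_of_pos_right hb hPp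
    rw [← e4] at h5
    have h6 : ‖γ*n‖ * ‖β/(γ*n) - z^n*(v z + z*deriv v z/n)‖ <
       ‖γ*n‖ * (‖1 - β/(γ*n)‖/2 * ‖1 + z^n * v z‖) := by linarith
    exact lt_of_mul_lt_mul_left h6 hgn.le)
  intro z hz h
  rw [← hPe z hz h, add_sub_cancel_left]
  exact main z hz

/-- **Theorem 1, case `0 < α ≤ 1/2`.**
If `f ∈ A_n`, nonvanishing on `U \ {0}` with nonvanishing derivative on `U`,
and for complex `β, γ` with `γ ≠ 0`, `Re(β/γ) < n` one has
`|(β − γ)·(z f'(z)/f(z)) + γ·(1 + z f''(z)/f'(z))| < (1/2)|nγ − β|` on `U`,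
then `|f(z)/(z f'(z)) − 1/(2α)| < 1/(2α)` on `U`; in particular
`f ∈ S*(α)`, i.e. `Re(z f'(z)/f(z)) > α` on `U`. -/
theorem mocanu_thm_starlike_small_alpha
    (n : ℕ) (hn : 1 ≤ n) (f : ℂ → ℂ)
    (hf : AnalyticOn ℂ f (ball (0 : ℂ) 1))
    (hf0 : f 0 = 0) (hf'0 : deriv f 0 = 1)
    (hcoef : ∀ k : ℕ, 2 ≤ k → k ≤ n → iteratedDeriv k f 0 = 0)
    (hfne : ∀ z ∈ ball (0 : ℂ) 1, z ≠ 0 → f z ≠ 0)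
    (hf'ne : ∀ z ∈ ball (0 : ℂ) 1, deriv f z ≠ 0)
    (α : ℝ) (hα0 : 0 < α) (hα : α ≤ 1 / 2)
    (β γ : ℂ) (hγ : γ ≠ 0)
    (hre : (β / γ).re < (n : ℝ))
    (hbound : ∀ z ∈ ball (0 : ℂ) 1, z ≠ 0 →
      ‖(β - γ) * (z * deriv f z / f z)
          + γ * (1 + z * deriv (deriv f) z / deriv f z)‖
        < (1 / 2) * ‖(n : ℂ) * γ - β‖) :
    ∀ z ∈ ball (0 : ℂ) 1, z ≠ 0 →
      ‖f z / (z * deriv f z) - 1 / (2 * α)‖ < 1 / (2 * α) ∧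
      α < (z * deriv f z / f z).re := by
  intro z hz h
  have hw := bound_w n hn f hf.differentiableOn hf0 hf'0 hcoef hfne hf'ne β γ hγ hbound z hz h
  have hp0 : f z / (z * deriv f z) ≠ 0 :=
    div_ne_zero (hfne z hz h) (mul_ne_zero h (hf'ne z hz))
  have hinv : z * deriv f z / f z = (f z / (z * deriv f z))⁻¹ := by rw [inv_div]
  rw [hinv]
  obtain ⟨p, hp⟩ : ∃ p, p = f z / (z * deriv f z) := ⟨_, rfl⟩
  rw [← hp] at hw hp0 ⊢
  obtain ⟨c, hc⟩ : ∃ c : ℝ, c = 1/(2*α) := ⟨_, rfl⟩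
  have hc1 : 1 ≤ c := by rw [hc, le_div_iff₀ (by positivity)]; linarith
  have hcc : (1:ℂ)/(2*α) = (c:ℂ) := by rw [hc]; push_cast; rfl
  rw [hcc, ← hc]
  have h1 : ‖p - c‖ < c := by
    have e : p - c = (p - 1) + ((1 - c : ℝ):ℂ) := by push_cast; ring
    have h2 := norm_add_le (p-1) ((1 - c : ℝ):ℂ)
    rw [← e, Complex.norm_real, Real.norm_of_nonpos (by linarith)] at h2
    linarith
  refine ⟨h1, ?_⟩
  have h2 : ‖p - c‖^2 < c^2 := pow_lt_pow_left₀ h1 (norm_nonneg _) (by norm_num)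
  have h3 : ‖p - c‖^2 = normSq p - 2*c*p.re + c^2 := by
    rw [Complex.sq_norm, Complex.normSq_apply, Complex.normSq_apply]
    simp only [sub_re, sub_im, ofReal_re, ofReal_im]; ring
  rw [Complex.inv_re, lt_div_iff₀ (Complex.normSq_pos.2 hp0)]
  have h4 : α*(2*c) = 1 := by rw [hc]; field_simp
  have h5 : α * normSq p < α*(2*c*p.re) := mul_lt_mul_of_pos_left (by linarith) hα0
  have h6 : α*(2*c*p.re) = p.re := by linear_combination p.re*h4
  linarith
end

section
/- Let n ≥ 1 and let f ∈ A_n with f(z) ≠ 0 for all z ∈ U \ {0} and f'(z) ≠ 0 for all z ∈ U. Let 0 < α ≤ 1/2 be real and let γ be a real number with γ > −1/n. If |(1 + γ)·(z f'(z)/f(z)) − γ·(1 + z f''(z)/f'(z))| < (1/2)(nγ + 1) for all z ∈ U, then |f(z)/(z f'(z)) − 1/(2α)| < 1/(2α) for all z ∈ U \ {0};ic in particular f ∈ S*(α). -/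
open Complex Metric

open Filter Topology in
/-- Jack's lemma. -/
lemma jack_aux (n : ℕ) (G : ℂ → ℂ) (hG : DifferentiableOn ℂ G (ball 0 1))
    (z0 : ℂ) (hz0 : z0 ∈ ball (0:ℂ) 1) (hne : z0 ≠ 0)
    (h1 : ‖z0 ^ n * G z0‖ = 1) (hle : ∀ z : ℂ, ‖z‖ ≤ ‖z0‖ → ‖z ^ n * G z‖ ≤ 1) :
    ∃ m : ℝ, (n : ℝ) ≤ m ∧
      z0 * deriv (fun z => z ^ n * G z) z0 = m * (z0 ^ n * G z0) := by
  have hr : 0 < ‖z0‖ := norm_pos_iff.2 hne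
  have hr1 : ‖z0‖ < 1 := by simpa using hz0
  have hGle : ∀ z : ℂ, ‖z‖ ≤ ‖z0‖ → ‖z0‖ ^ n * ‖G z‖ ≤ 1 := by
    intro z hz
    have hsub : closedBall (0:ℂ) ‖z0‖ ⊆ ball 0 1 := closedBall_subset_ball hr1
    have hd : DiffContOnCl ℂ G (ball 0 ‖z0‖) :=
      (hG.mono (closure_ball_subset_closedBall.trans hsub)).diffContOnCl
    have := Complex.norm_le_of_forall_mem_frontier_norm_le (U := ball (0:ℂ) ‖z0‖)
      isBounded_ball hd (C := 1 / ‖z0‖ ^ n) ?_ (z := z) ?_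
    · rw [le_div_iff₀ (by positivity)] at this
      linarith
    · intro x hx
      rw [frontier_ball _ hr.ne'] at hx
      have hx' : ‖x‖ = ‖z0‖ := by simpa using hx
      have := hle x hx'.le
      rw [norm_mul, norm_pow, hx'] at this
      rw [le_div_iff₀ (by positivity)]
      linarith
    · rw [closure_ball _ hr.ne']; simpa using hz
  set w : ℂ → ℂ := fun z => z ^ n * G z with hw
  set c : ℂ := (starRingEnd ℂ) (w z0) with hc
  have hcn : ‖c‖ = 1 := by rw [hc, Complex.norm_conj]; exact h1
  have hwc : w z0 * c = 1 := by
    rw [hc, Complex.mul_conj, Complex.normSq_eq_norm_sq]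
    have : ‖w z0‖ = 1 := h1
    rw [this]; simp
  have hGd : DifferentiableAt ℂ G z0 := hG.differentiableAt (isOpen_ball.mem_nhds hz0)
  have hwd : DifferentiableAt ℂ w z0 := by
    rw [hw]; fun_prop
  set k : ℂ → ℂ := fun ζ => w (z0 * exp ζ) * c * exp (-(n * ζ)) with hk
  have hkd : HasDerivAt k (z0 * deriv w z0 * c - n) 0 := by
    have e1 : HasDerivAt (fun ζ : ℂ => z0 * exp ζ) z0 0 := by
      simpa using (Complex.hasDerivAt_exp 0).const_mul z0
    have e2 : HasDerivAt w (deriv w z0) (z0 * exp 0) := by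
      simpa using hwd.hasDerivAt
    have e3 : HasDerivAt (fun ζ : ℂ => w (z0 * exp ζ)) (deriv w z0 * z0) 0 :=
      HasDerivAt.comp (h₂ := w) (h := fun ζ : ℂ => z0 * exp ζ) (0:ℂ) e2 e1
    have e4 : HasDerivAt (fun ζ : ℂ => exp (-(n * ζ))) (-(n:ℂ)) 0 := by
      have := (((hasDerivAt_id (0:ℂ)).const_mul (n:ℂ)).neg).cexp
      simpa using this
    have := (e3.mul_const c).mul e4
    refine this.congr_deriv ?_
    simp only [exp_zero, mul_one, mul_zero, neg_zero]
    linear_combination (-(n:ℂ)) * hwc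
  have hkle : ∀ ζ : ℂ, ζ.re ≤ 0 → (k ζ).re ≤ 1 := by
    intro ζ hζ
    refine (Complex.re_le_norm _).trans ?_
    have hn' : ‖z0 * exp ζ‖ ≤ ‖z0‖ := by
      rw [norm_mul, Complex.norm_exp]
      exact mul_le_of_le_one_right hr.le (Real.exp_le_one_iff.2 hζ)
    have := hGle _ hn'
    have e : k ζ = (z0 ^ n * G (z0 * exp ζ) * c) := by
      have : exp ζ ^ n * exp (-(n * ζ)) = 1 := by
        rw [← Complex.exp_nat_mul, ← Complex.exp_add]; simp
      simp only [hk, hw, mul_pow]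
      linear_combination (z0 ^ n * G (z0 * exp ζ) * c) * this
    rw [e, norm_mul, hcn, norm_mul, norm_pow, mul_one]
    exact this
  have hk0 : k 0 = 1 := by simp [hk, hwc]
  have key : ∀ v : ℂ, v.re ≤ 0 → (v * (z0 * deriv w z0 * c - n)).re ≤ 0 := by
    intro v hv
    have hmax : IsLocalMaxOn (fun ζ => (k ζ).re) {ζ : ℂ | ζ.re ≤ 0} 0 := by
      have : IsMaxOn (fun ζ => (k ζ).re) {ζ : ℂ | ζ.re ≤ 0} 0 := by
        intro ζ hζ
        have := hkle ζ hζ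
        simpa [hk0] using this
      exact this.localize
    have hfd : HasFDerivAt (fun ζ => (k ζ).re) _ 0 :=
      (Complex.reCLM.hasFDerivAt).comp (0:ℂ) (hkd.hasFDerivAt.restrictScalars ℝ)
    have hcone : v ∈ posTangentConeAt {ζ : ℂ | ζ.re ≤ 0} 0 := by
      apply mem_posTangentConeAt_of_segment_subset
      have hcv : Convex ℝ {ζ : ℂ | ζ.re ≤ 0} := convex_halfSpace_re_le 0
      exact hcv.segment_subset (by simp) (by simpa using hv)
    have := hmax.hasFDerivWithinAt_nonpos hfd.hasFDerivWithinAt hcone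
    simpa using this
  have k1 := key (-1) (by simp)
  have k2 := key I (by simp)
  have k3 := key (-I) (by simp)
  set D := z0 * deriv w z0 * c - n with hD
  have hre : 0 ≤ D.re := by simp at k1; linarith
  have him : D.im = 0 := by
    simp at k2 k3
    linarith
  refine ⟨D.re + n, by linarith, ?_⟩
  have hDr : D = (D.re : ℂ) := by
    apply Complex.ext <;> simp [him]
  have : z0 * deriv w z0 * c = ((D.re + n : ℝ) : ℂ) := by
    push_cast
    rw [← hDr, hD]; ring
  change z0 * deriv w z0 = _ * w z0
  rw [← this]
  linear_combination (-(z0 * deriv w z0)) * hwc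

open Filter Topology in
lemma factor_aux (n : ℕ) (hn : 1 ≤ n) (f : ℂ → ℂ)
    (hf : AnalyticOnNhd ℂ f (ball (0 : ℂ) 1))
    (hf0 : f 0 = 0) (hf'0 : deriv f 0 = 1)
    (hcoef : ∀ k : ℕ, 2 ≤ k → k ≤ n → iteratedDeriv k f 0 = 0)
    (hf'ne : ∀ z ∈ ball (0 : ℂ) 1, deriv f z ≠ 0) :
    ∃ G : ℂ → ℂ, DifferentiableOn ℂ G (ball 0 1) ∧
      ∀ z ∈ ball (0:ℂ) 1, f z = z * deriv f z * (1 + z ^ n * G z) := by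
  have h0 : (0:ℂ) ∈ ball (0:ℂ) 1 := by simp
  have ha : AnalyticAt ℂ f 0 := hf 0 h0
  have hb : AnalyticAt ℂ (fun z => f z - z) 0 := by fun_prop
  have hord : ((n + 1 : ℕ) : ℕ∞) ≤ analyticOrderAt (fun z => f z - z) 0 := by
    rw [natCast_le_analyticOrderAt_iff_iteratedDeriv_eq_zero hb]
    intro i hi
    rw [iteratedDeriv_fun_sub ha.contDiffAt (by fun_prop)]
    rcases i with _ | _ | i
    · simp [hf0]
    · simp [iteratedDeriv_one, hf'0]
    · rw [hcoef _ (by omega) (by omega), iteratedDeriv_fun_id_zero]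
      simp
  obtain ⟨g, hg, hfg⟩ := (natCast_le_analyticOrderAt hb).1 hord
  simp only [sub_zero, smul_eq_mul] at hfg
  let H : ℂ → ℂ := fun z => (-(n:ℂ) * g z - z * deriv g z) / deriv f z
  have hH : AnalyticAt ℂ H 0 := by
    have := hg.deriv
    have := ha.deriv
    have h := hf'ne 0 h0
    exact AnalyticAt.div (by fun_prop) (by fun_prop) h
  let G : ℂ → ℂ := fun z => if z = 0 then H 0 else (f z / (z * deriv f z) - 1) / z ^ n
  have hGH : G =ᶠ[𝓝 0] H := by
    have hball : ∀ᶠ z in 𝓝 (0:ℂ), z ∈ ball (0:ℂ) 1 := isOpen_ball.mem_nhds h0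
    filter_upwards [hfg.eventually_nhds, hg.eventually_analyticAt, hball] with z hz hgz hzb
    by_cases hz0 : z = 0
    · simp [G, hz0]
    have hv := hz.self_of_nhds
    have hfz : HasDerivAt f (deriv f z) z := (hf z hzb).differentiableAt.hasDerivAt
    have d1 : HasDerivAt (fun z => f z - z) (deriv f z - 1) z := hfz.sub (hasDerivAt_id z)
    have d2 := ((hasDerivAt_id z).pow (n+1)).mul hgz.differentiableAt.hasDerivAt
    have d3 := d2.congr_of_eventuallyEq (f₁ := fun z => f z - z)
      (by filter_upwards [hz] with x hx; simpa using hx)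
    have he := d1.unique d3
    simp only [Nat.cast_add, Nat.cast_one, add_tsub_cancel_right, id, Pi.pow_apply, mul_one] at he
    simp only [G, H, hz0, if_false]
    have hne := hf'ne z hzb
    field_simp
    linear_combination hv - z * he
  refine ⟨G, ?_, ?_⟩
  · intro z hz
    apply DifferentiableAt.differentiableWithinAt
    by_cases hz0 : z = 0
    · rw [hz0]
      exact (hH.congr hGH.symm).differentiableAt
    · have e : (fun z => (f z / (z * deriv f z) - 1) / z ^ n) =ᶠ[𝓝 z] G := by
        filter_upwards [isOpen_ne.mem_nhds hz0] with x hx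
        simp only [G]
        rw [if_neg hx]
      refine DifferentiableAt.congr_of_eventuallyEq ?_ e.symm
      have a1 := (hf z hz).differentiableAt
      have a2 := (hf z hz).deriv.differentiableAt
      have := hf'ne z hz
      have h3 : z * deriv f z ≠ 0 := mul_ne_zero hz0 this
      have h4 : z ^ n ≠ 0 := pow_ne_zero _ hz0
      exact DifferentiableAt.div ((a1.div (differentiableAt_id.mul a2) h3).sub_const 1)
        (by fun_prop) h4
  · intro z hz
    by_cases hz0 : z = 0
    · simp [hz0, hf0]
    · have := hf'ne z hz
      simp only [G, hz0, if_false]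
      field_simp
      ring

open Filter Topology in
/-- **Corollary 1, case `0 < α ≤ 1/2`.**
If `f ∈ A_n`, nonvanishing on `U \ {0}` with nonvanishing derivative on `U`,
and for a real `γ > −1/n` one has
`|(1 + γ)·(z f'(z)/f(z)) − γ·(1 + z f''(z)/f'(z))| < (1/2)(nγ + 1)` on `U`,
then `|f(z)/(z f'(z)) − 1/(2α)| < 1/(2α)` on `U`; in particular
`f ∈ S*(α)`, i.e. `Re(z f'(z)/f(z)) > α` on `U`. -/
theorem mocanu_cor_starlike_small_alpha
    (n : ℕ) (hn : 1 ≤ n) (f : ℂ → ℂ)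
    (hf : AnalyticOn ℂ f (ball (0 : ℂ) 1))
    (hf0 : f 0 = 0) (hf'0 : deriv f 0 = 1)
    (hcoef : ∀ k : ℕ, 2 ≤ k → k ≤ n → iteratedDeriv k f 0 = 0)
    (hfne : ∀ z ∈ ball (0 : ℂ) 1, z ≠ 0 → f z ≠ 0)
    (hf'ne : ∀ z ∈ ball (0 : ℂ) 1, deriv f z ≠ 0)
    (α : ℝ) (hα0 : 0 < α) (hα : α ≤ 1 / 2)
    (γ : ℝ) (hγ : -(1 / (n : ℝ)) < γ)
    (hbound : ∀ z ∈ ball (0 : ℂ) 1, z ≠ 0 →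
      ‖(1 + (γ : ℂ)) * (z * deriv f z / f z)
          - (γ : ℂ) * (1 + z * deriv (deriv f) z / deriv f z)‖
        < (1 / 2) * ((n : ℝ) * γ + 1)) :
    ∀ z ∈ ball (0 : ℂ) 1, z ≠ 0 →
      ‖f z / (z * deriv f z) - 1 / (2 * α)‖ < 1 / (2 * α) ∧
      α < (z * deriv f z / f z).re := by
  have hfa : AnalyticOnNhd ℂ f (ball (0 : ℂ) 1) := (isOpen_ball.analyticOn_iff_analyticOnNhd).1 hf
  obtain ⟨G, hG, hfG⟩ := factor_aux n hn f hfa hf0 hf'0 hcoef hf'ne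
  have h0 : (0:ℂ) ∈ ball (0:ℂ) 1 := by simp
  have hn0 : n ≠ 0 := by omega
  set w : ℂ → ℂ := fun z => z ^ n * G z with hw
  have hwd : DifferentiableOn ℂ w (ball 0 1) := by rw [hw]; fun_prop
  have hw0 : w 0 = 0 := by simp [hw, hn0]
  have hfw : ∀ z ∈ ball (0:ℂ) 1, f z = z * deriv f z * (1 + w z) := hfG
  have hw1 : ∀ z ∈ ball (0:ℂ) 1, 1 + w z ≠ 0 := by
    intro z hz h
    by_cases hz0 : z = 0
    · simp [hz0, hw0] at h
    · apply hfne z hz hz0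
      rw [hfw z hz, h, mul_zero]
  -- the bound in terms of `w`
  have hB : ∀ z ∈ ball (0:ℂ) 1, z ≠ 0 →
      ‖(1 + γ * (z * deriv w z)) / (1 + w z)‖ < (1 / 2) * ((n : ℝ) * γ + 1) := by
    intro z hz hz0
    have hb := hbound z hz hz0
    have a1 := (hfa z hz).differentiableAt.hasDerivAt
    have a2 := (hfa z hz).deriv.differentiableAt.hasDerivAt
    have a3 := (hwd.differentiableAt (isOpen_ball.mem_nhds hz)).hasDerivAt
    have a4 := ((hasDerivAt_id z).mul a2).mul (a3.const_add 1)
    have a5 := a4.congr_of_eventuallyEq (f₁ := f)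
      (by filter_upwards [isOpen_ball.mem_nhds hz] with x hx; simpa using hfw x hx)
    have he := a1.unique a5
    simp only [Pi.mul_apply, id, one_mul] at he
    have n1 := hw1 z hz
    have n2 := hf'ne z hz
    convert hb using 2
    rw [hfw z hz]
    field_simp
    linear_combination (-(γ:ℂ)) * he
  -- `γ > 0`
  have hM : 1 ≤ (1 / 2) * ((n : ℝ) * γ + 1) := by
    have hwa : AnalyticAt ℂ w 0 := hwd.analyticAt (isOpen_ball.mem_nhds h0)
    have hc : ContinuousAt (fun z => ‖(1 + γ * (z * deriv w z)) / (1 + w z)‖) 0 := by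
      have c1 := hwa.continuousAt
      have c2 := hwa.deriv.continuousAt
      have := hw1 0 h0
      exact ContinuousAt.norm (ContinuousAt.div (by fun_prop) (by fun_prop) this)
    have ht : Tendsto (fun z => ‖(1 + γ * (z * deriv w z)) / (1 + w z)‖) (𝓝[≠] 0) (𝓝 1) := by
      have := hc.tendsto
      simp only [hw0, zero_mul, mul_zero, add_zero, div_one, norm_one] at this
      exact this.mono_left nhdsWithin_le_nhds
    refine le_of_tendsto ht ?_
    filter_upwards [self_mem_nhdsWithin, nhdsWithin_le_nhds (isOpen_ball.mem_nhds h0)] with z h1 h2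
    exact (hB z h2 h1).le
  have hnp : (0:ℝ) < n := by exact_mod_cast hn
  have hγ0 : 0 < γ := by
    by_contra h
    push Not at h
    nlinarith
  have hwlt : ∀ z ∈ ball (0:ℂ) 1, ‖w z‖ < 1 := by
    intro z1 hz1
    by_contra hcon
    push Not at hcon
    have hz1' : ‖z1‖ < 1 := by simpa using hz1
    have hsub : closedBall (0:ℂ) ‖z1‖ ⊆ ball 0 1 := closedBall_subset_ball hz1'
    have hK : IsCompact (closedBall (0:ℂ) ‖z1‖ ∩ {z | 1 ≤ ‖w z‖}) := by
      have : IsClosed (closedBall (0:ℂ) ‖z1‖ ∩ (fun z => ‖w z‖) ⁻¹' (Set.Ici 1)) :=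
        ((hwd.continuousOn.mono hsub).norm).preimage_isClosed_of_isClosed isClosed_closedBall
          isClosed_Ici
      exact (isCompact_closedBall (0:ℂ) ‖z1‖).of_isClosed_subset this Set.inter_subset_left
    obtain ⟨z0, ⟨hz0a, hz0b⟩, hmin⟩ := hK.exists_isMinOn ⟨z1, by simp, hcon⟩
      continuous_norm.continuousOn
    have hz0 := hsub hz0a
    have hz0n : ‖z0‖ ≤ ‖z1‖ := by simpa using hz0a
    have hlt : ∀ z : ℂ, ‖z‖ < ‖z0‖ → ‖w z‖ < 1 := by
      intro z hz
      by_contra h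
      push Not at h
      have : ‖z0‖ ≤ ‖z‖ := hmin ⟨by simpa using (hz.le.trans hz0n), h⟩
      linarith
    have hne : z0 ≠ 0 := by
      rintro rfl
      simp only [Set.mem_ofPred_eq, hw0, norm_zero] at hz0b
      linarith
    have hr : 0 < ‖z0‖ := norm_pos_iff.2 hne
    have hle : ∀ z : ℂ, ‖z‖ ≤ ‖z0‖ → ‖w z‖ ≤ 1 := by
      intro z hz
      have hzb : z ∈ ball (0:ℂ) 1 := by
        have : ‖z‖ < 1 := by linarith
        simpa using this
      have hcl : z ∈ closure (ball (0:ℂ) ‖z0‖) := by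
        rw [closure_ball _ hr.ne']; simpa using hz
      have hcont : ContinuousWithinAt (fun z => ‖w z‖) (ball (0:ℂ) ‖z0‖) z :=
        (hwd.differentiableAt (isOpen_ball.mem_nhds hzb)).continuousAt.norm.continuousWithinAt
      have : (𝓝[ball (0:ℂ) ‖z0‖] z).NeBot := mem_closure_iff_nhdsWithin_neBot.1 hcl
      refine le_of_tendsto hcont ?_
      filter_upwards [self_mem_nhdsWithin] with x hx
      exact (hlt x (by simpa using hx)).le
    have heq : ‖w z0‖ = 1 := le_antisymm (hle z0 le_rfl) hz0b
    obtain ⟨m, hm, hmw⟩ := jack_aux n G hG z0 hz0 hne heq hle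
    have hb := hB z0 hz0 hne
    change z0 * deriv w z0 = m * w z0 at hmw
    rw [hmw, norm_div, div_lt_iff₀ (norm_pos_iff.2 (hw1 z0 hz0))] at hb
    have hsq := pow_lt_pow_left₀ hb (norm_nonneg _) two_ne_zero
    rw [mul_pow, ← Complex.normSq_eq_norm_sq, ← Complex.normSq_eq_norm_sq,
      Complex.normSq_apply, Complex.normSq_apply] at hsq
    have hun : (w z0).re * (w z0).re + (w z0).im * (w z0).im = 1 := by
      rw [← Complex.normSq_apply, Complex.normSq_eq_norm_sq, heq]; norm_num
    have e1 : (1 + γ * (m * w z0) : ℂ).re = 1 + γ * m * (w z0).re := by simp; ring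
    have e2 : (1 + γ * (m * w z0) : ℂ).im = γ * m * (w z0).im := by simp; ring
    have e3 : (1 + w z0).re = 1 + (w z0).re := by simp
    have e4 : (1 + w z0).im = (w z0).im := by simp
    rw [e1, e2, e3, e4] at hsq
    generalize (w z0).re = x at *
    generalize (w z0).im = y at *
    have hx1 : x ≤ 1 := by nlinarith
    have hx2 : -1 ≤ x := by nlinarith
    have q1 : ((n:ℝ) * γ + 1) ^ 2 ≤ (1 + γ * m) ^ 2 := by
      have : (n:ℝ) * γ ≤ γ * m := by nlinarith
      have : 0 < (n:ℝ) * γ := by positivity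
      nlinarith
    have q2 : 0 ≤ (1 + x) * ((1 + γ * m) ^ 2 - ((n:ℝ) * γ + 1) ^ 2) :=
      mul_nonneg (by linarith) (by linarith)
    have q3 : 0 ≤ (1 - x) * (1 - γ * m) ^ 2 := mul_nonneg (by linarith) (by positivity)
    have r1 : (1 + γ * m * x) * (1 + γ * m * x) + γ * m * y * (γ * m * y)
        = 1 + 2 * (γ * m * x) + (γ * m) ^ 2 := by
      linear_combination (γ * m) ^ 2 * hun
    have r2 : (1 + x) * (1 + x) + y * y = 2 + 2 * x := by linear_combination hun
    rw [r1, r2] at hsq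
    nlinarith
  intro z hz hz0
  have hq : f z / (z * deriv f z) = 1 + w z := by
    have := hf'ne z hz
    nth_rewrite 1 [hfw z hz]
    field_simp
  have hR : 1 ≤ 1 / (2 * α) := by
    rw [le_div_iff₀ (by positivity)]; linarith
  have hA : ‖f z / (z * deriv f z) - 1 / (2 * α)‖ < 1 / (2 * α) := by
    rw [hq]
    have e : (1 + w z - 1 / (2 * α) : ℂ) = w z + ((1 - 1 / (2 * α) : ℝ) : ℂ) := by
      push_cast; ring
    rw [e]
    have := norm_add_le (w z) ((1 - 1 / (2 * α) : ℝ) : ℂ)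
    rw [Complex.norm_real, Real.norm_eq_abs, abs_of_nonpos (by linarith)] at this
    linarith [hwlt z hz]
  refine ⟨hA, ?_⟩
  have hinv : z * deriv f z / f z = (1 + w z)⁻¹ := by rw [← hq, inv_div]
  rw [hinv, Complex.inv_re]
  have hpos : 0 < Complex.normSq (1 + w z) := Complex.normSq_pos.2 (hw1 z hz)
  rw [lt_div_iff₀ hpos]
  have hs : Complex.normSq (w z) < 1 := by
    rw [Complex.normSq_eq_norm_sq]
    have := hwlt z hz
    have := norm_nonneg (w z)
    nlinarith
  rw [Complex.normSq_apply] at hs hpos ⊢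
  simp only [Complex.add_re, Complex.add_im, Complex.one_re, Complex.one_im, zero_add] at hpos ⊢
  nlinarith
end

section
/- Let n ≥ 1 and let f ∈ A_n with f(z) ≠ 0 for all z ∈ U \ {0} and f'(z) ≠ 0 for all z ∈ U. Let ρ > 0 be real and let β, γ be complex numbers with γ ≠ 0 and Re(β/γ) > −(n + 1). If |β·(z f'(z)/f(z) − 1) + γ·(z f''(z)/f'(z))| < (ρ/(1 + ρ))·|β + γ(n + 1)| for all z ∈ U, then |f(z)/(z f'(z)) − 1| < ρ for all z ∈ U \ {0} (and the analytic extension of f(z)/(z f'(z)) − 1 satisfies this bound on all of U). -/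
open Complex Metric

lemma deriv_nonneg_aux {φ : ℝ → ℝ} {c : ℝ} (h : HasDerivAt φ c 1)
    (h1 : ∀ t, 0 < t → t < 1 → φ t ≤ φ 1) : 0 ≤ c := by
  have h2 : Filter.Tendsto (slope φ 1) (nhdsWithin 1 (Set.Iio 1)) (nhds c) :=
    (hasDerivAt_iff_tendsto_slope.1 h).mono_left
      (nhdsWithin_mono _ (fun x (hx : x < 1) => ne_of_lt hx))
  refine ge_of_tendsto h2 ?_
  filter_upwards [Ioo_mem_nhdsLT (show (0:ℝ) < 1 by norm_num)] with t ht
  rw [slope_def_field]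
  apply div_nonneg_of_nonpos
  · linarith [h1 t ht.1 ht.2]
  · linarith [ht.2]

lemma jack (w : ℂ → ℂ) (n : ℕ) (hn : 1 ≤ n) (hd : DifferentiableOn ℂ w (ball 0 1))
    (hw0 : w 0 = 0) (hO : w =O[nhds 0] (fun z => z ^ n)) (z0 : ℂ) (hz0 : z0 ∈ ball (0:ℂ) 1)
    (hz : z0 ≠ 0) (hne : w z0 ≠ 0) (hmax : ∀ z, ‖z‖ ≤ ‖z0‖ → ‖w z‖ ≤ ‖w z0‖) :
    ∃ k : ℝ, (n : ℝ) ≤ k ∧ z0 * deriv w z0 = k * w z0 := by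
  have hwd : HasDerivAt w (deriv w z0) z0 :=
    (hd.differentiableAt (isOpen_ball.mem_nhds hz0)).hasDerivAt
  have hr : 0 < ‖z0‖ := norm_pos_iff.2 hz
  have hρ : 0 < ‖w z0‖ := norm_pos_iff.2 hne
  have hr1 : ‖z0‖ < 1 := by simpa using hz0
  have hS : ∀ z, ‖z‖ < ‖z0‖ → ‖w z‖ ≤ ‖w z0‖ * (‖z‖ / ‖z0‖) ^ n := by
    intro z hzz
    obtain ⟨m, rfl⟩ : ∃ m, n = m + 1 := ⟨n - 1, by omega⟩
    have := Complex.dist_le_mul_div_pow_of_mapsTo_ball_of_isLittleO (f := w) (c := 0) (z := z)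
      (R₁ := ‖z0‖) (R₂ := ‖w z0‖) (n := m) (hd.mono (ball_subset_ball hr1.le)) ?_ ?_ (by simpa using hzz)
    · simpa [hw0] using this
    · intro x hx
      simp only [hw0, mem_closedBall, dist_zero_right]
      exact hmax x (by simpa using (mem_ball_zero_iff.1 hx).le)
    · simp only [hw0, sub_zero]
      refine hO.trans_isLittleO ?_
      have : (fun z : ℂ => z ^ (m+1)) =o[nhds 0] (fun z : ℂ => z ^ m) :=
        Asymptotics.isLittleO_pow_pow (by omega)
      simpa [norm_pow] using this.norm_right
  -- radial
  have hrad : HasDerivAt (fun t : ℝ => w (t * z0)) (z0 * deriv w z0) 1 := by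
    have h1 : HasDerivAt (fun t : ℂ => w (t * z0)) (z0 * deriv w z0) ((1:ℝ):ℂ) := by
      have := HasDerivAt.comp (h₂ := w) (h := fun t : ℂ => t * z0) (h₂' := deriv w z0) (h' := z0) ((1:ℝ):ℂ)
        (by simpa using hwd) (by simpa using (hasDerivAt_id ((1:ℝ):ℂ)).mul_const z0)
      simpa [mul_comm, Function.comp_def] using this
    exact h1.comp_ofReal
  have hang : HasDerivAt (fun t : ℝ => w (Complex.exp (t * I) * z0)) (I * (z0 * deriv w z0)) 0 := by
    have h1 : HasDerivAt (fun t : ℂ => w (Complex.exp (t * I) * z0)) (I * (z0 * deriv w z0)) ((0:ℝ):ℂ) := by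
      have he : HasDerivAt (fun t : ℂ => Complex.exp (t * I) * z0) (I * z0) ((0:ℝ):ℂ) := by
        have := (((hasDerivAt_id ((0:ℝ):ℂ)).mul_const I).cexp).mul_const z0
        simpa using this
      have := HasDerivAt.comp (h₂ := w) (h := fun t : ℂ => Complex.exp (t * I) * z0)
        (h₂' := deriv w z0) (h' := I * z0) ((0:ℝ):ℂ) (by simpa using hwd) he
      exact this.congr_deriv (by ring)
    exact h1.comp_ofReal
  have hrad2 := hrad.norm_sq
  have hang2 := hang.norm_sq
  have e1 := IsLocalMax.hasDerivAt_eq_zero (Filter.Eventually.of_forall (fun t => by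
    simp only [ofReal_zero, zero_mul, Complex.exp_zero, one_mul]
    gcongr
    apply hmax
    simp [Complex.norm_exp_ofReal_mul_I])) hang2
  have hpw : HasDerivAt (fun t : ℝ => ‖w z0‖ ^ 2 * t ^ (2 * n)) (‖w z0‖ ^ 2 * (2 * n)) 1 := by
    have := (hasDerivAt_pow (2 * n) (1:ℝ)).const_mul (‖w z0‖ ^ 2)
    simpa using this
  have e2 := deriv_nonneg_aux (hrad2.sub hpw) (by
    intro t h0 h1
    have h3 := hS (t * z0) (by
      simp only [norm_mul, norm_real, Real.norm_eq_abs, abs_of_pos h0]; nlinarith)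
    have h4 : ‖(t:ℂ) * z0‖ / ‖z0‖ = t := by
      simp only [norm_mul, norm_real, Real.norm_eq_abs, abs_of_pos h0]; field_simp
    rw [h4] at h3
    have h5 : ‖w (t * z0)‖ ^ 2 ≤ (‖w z0‖ * t ^ n) ^ 2 := by gcongr
    simp only [Pi.sub_apply, ofReal_one, one_mul, one_pow, mul_one, sub_self]
    rw [mul_pow, ← pow_mul, mul_comm n 2] at h5
    linarith)
  simp only [Complex.inner, ofReal_zero, zero_mul, Complex.exp_zero, one_mul, ofReal_one] at e1 e2
  set a := z0 * deriv w z0 with ha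
  set b := w z0 with hb
  have hb2 : ‖b‖ ^ 2 = b.re * b.re + b.im * b.im := by
    rw [← Complex.normSq_eq_norm_sq, Complex.normSq_apply]
  have hbp : 0 < ‖b‖ ^ 2 := by positivity
  simp only [mul_re, mul_im, conj_re, conj_im, I_re, I_im] at e1 e2
  refine ⟨(a.re * b.re + a.im * b.im) / ‖b‖ ^ 2, ?_, ?_⟩
  · rw [le_div_iff₀ hbp]; nlinarith
  · have e3 : a.im * b.re - a.re * b.im = 0 := by linarith
    apply Complex.ext
    · simp only [mul_re, ofReal_re, ofReal_im]
      field_simp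
      rw [hb2]; linear_combination (-b.im) * e3
    · simp only [mul_im, ofReal_re, ofReal_im]
      field_simp
      rw [hb2]; linear_combination (b.re) * e3

lemma order_aux (n : ℕ) (hn : 1 ≤ n) (f : ℂ → ℂ) (hf : AnalyticAt ℂ f 0)
    (hf0 : f 0 = 0) (hf'0 : deriv f 0 = 1)
    (hcoef : ∀ k : ℕ, 2 ≤ k → k ≤ n → iteratedDeriv k f 0 = 0) :
    (fun z => dslope f 0 z / deriv f z - 1) =O[nhds 0] (fun z => z ^ n) := by
  have hg : AnalyticAt ℂ (fun z => f z - z) 0 := hf.sub analyticAt_id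
  have hord : ((n + 1 : ℕ) : ℕ∞) ≤ analyticOrderAt (fun z => f z - z) 0 := by
    rw [natCast_le_analyticOrderAt_iff_iteratedDeriv_eq_zero hg]
    intro i hi
    rw [iteratedDeriv_fun_sub (g := fun z : ℂ => z) hf.contDiffAt contDiffAt_id, iteratedDeriv_fun_id_zero]
    rcases i with _ | _ | i
    · simp [hf0]
    · simp [hf'0]
    · simp [hcoef (i + 2) (by omega) (by omega)]
  obtain ⟨F, hF, hFe⟩ := (natCast_le_analyticOrderAt hg).1 hord
  have key : (fun z => dslope f 0 z / deriv f z - 1) =ᶠ[nhds 0]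
      (fun z => z ^ n * ((-(n:ℂ) * F z - z * deriv F z) / deriv f z)) := by
    have hne : ∀ᶠ z in nhds (0:ℂ), deriv f z ≠ 0 :=
      hf.deriv.continuousAt.eventually_ne (by simp [hf'0])
    filter_upwards [hFe.eventually_nhds, hF.eventually_analyticAt, hne] with z h1 h2 h3
    have h4 : f =ᶠ[nhds z] fun z => z + z ^ (n+1) * F z := by
      filter_upwards [h1] with y hy
      simp only [sub_zero, smul_eq_mul] at hy
      linear_combination hy
    have h5 : deriv f z = 1 + ((n+1) * z ^ n * F z + z ^ (n+1) * deriv F z) := by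
      rw [h4.deriv_eq]
      have := (hasDerivAt_id z).add ((hasDerivAt_pow (n+1) z).mul h2.differentiableAt.hasDerivAt)
      have := this.deriv
      simp at this
      exact this
    have h6 : dslope f 0 z = 1 + z ^ n * F z := by
      by_cases hz : z = 0
      · subst hz; simp [hf'0, show n ≠ 0 by omega]
      · rw [dslope_of_ne _ hz, slope_def_field, hf0, h4.eq_of_nhds]
        field_simp; ring
    field_simp
    rw [h6, h5]; ring
  refine key.trans_isBigO ?_
  have hc : ContinuousAt (fun z => (-(n:ℂ) * F z - z * deriv F z) / deriv f z) 0 := by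
    have := hF.continuousAt
    have := hF.deriv.continuousAt
    have := hf.deriv.continuousAt
    exact ContinuousAt.div (by fun_prop) (by fun_prop) (by simp [hf'0])
  simpa using (Asymptotics.isBigO_refl (fun z : ℂ => z ^ n) (nhds 0)).mul (hc.isBigO_one ℂ)

theorem mocanu_lemma2_starlike_bound
    (n : ℕ) (hn : 1 ≤ n) (f : ℂ → ℂ)
    (hf : AnalyticOn ℂ f (ball (0 : ℂ) 1))
    (hf0 : f 0 = 0) (hf'0 : deriv f 0 = 1)
    (hcoef : ∀ k : ℕ, 2 ≤ k → k ≤ n → iteratedDeriv k f 0 = 0)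
    (hfne : ∀ z ∈ ball (0 : ℂ) 1, z ≠ 0 → f z ≠ 0)
    (hf'ne : ∀ z ∈ ball (0 : ℂ) 1, deriv f z ≠ 0)
    (β γ : ℂ) (hγ : γ ≠ 0) (ρ : ℝ) (hρ : 0 < ρ)
    (hre : -((n : ℝ) + 1) < (β / γ).re)
    (hbound : ∀ z ∈ ball (0 : ℂ) 1, z ≠ 0 →
      ‖β * (z * deriv f z / f z - 1)
          + γ * (z * deriv (deriv f) z / deriv f z)‖
        < (ρ / (1 + ρ)) * ‖β + γ * ((n : ℂ) + 1)‖) :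
    ∀ z ∈ ball (0 : ℂ) 1, z ≠ 0 → ‖f z / (z * deriv f z) - 1‖ < ρ := by
  have hfN : AnalyticOnNhd ℂ f (ball 0 1) := (isOpen_ball.analyticOn_iff_analyticOnNhd).1 hf
  set w : ℂ → ℂ := fun z => dslope f 0 z / deriv f z - 1 with hw
  have h0 : (0:ℂ) ∈ ball (0:ℂ) 1 := by simp
  have hO : w =O[nhds 0] (fun z => z ^ n) := order_aux n hn f (hfN 0 h0) hf0 hf'0 hcoef
  have hw0 : w 0 = 0 := by simp [hw, hf'0]
  have hwz : ∀ z, z ≠ 0 → w z = f z / (z * deriv f z) - 1 := by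
    intro z hz
    simp only [hw]
    rw [dslope_of_ne _ hz, slope_def_field, hf0]
    simp [div_div]
  have hd : DifferentiableOn ℂ w (ball 0 1) := by
    apply DifferentiableOn.sub_const
    apply DifferentiableOn.div _ hfN.deriv.differentiableOn hf'ne
    exact (differentiableOn_dslope (isOpen_ball.mem_nhds h0)).2 hfN.differentiableOn
  intro z1 hz1 hz1ne
  rw [← hwz z1 hz1ne]
  by_contra hcon
  push Not at hcon
  have hz1' : ‖z1‖ < 1 := by simpa using hz1
  have hsub : closedBall (0:ℂ) ‖z1‖ ⊆ ball 0 1 := closedBall_subset_ball hz1'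
  have hK : IsCompact (closedBall (0:ℂ) ‖z1‖ ∩ (fun z => ‖w z‖) ⁻¹' Set.Ici ρ) :=
    (isCompact_closedBall _ _).of_isClosed_subset
      ((hd.continuousOn.mono hsub).norm.preimage_isClosed_of_isClosed isClosed_closedBall isClosed_Ici)
      Set.inter_subset_left
  obtain ⟨z0, ⟨hz0a, hz0b⟩, hmin⟩ := hK.exists_isMinOn ⟨z1, by simp, hcon⟩ continuous_norm.continuousOn
  simp only [Set.mem_preimage, Set.mem_Ici] at hz0b
  have hz0 : z0 ∈ ball (0:ℂ) 1 := hsub hz0a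
  have hz0ne : z0 ≠ 0 := by
    rintro rfl
    simp [hw0] at hz0b; linarith
  have hlt : ∀ z ∈ ball (0:ℂ) ‖z0‖, ‖w z‖ ≤ ρ := by
    intro z hz
    by_contra hc
    push Not at hc
    have hz' : ‖z‖ < ‖z0‖ := by simpa using hz
    have hz0a' : ‖z0‖ ≤ ‖z1‖ := by simpa using hz0a
    have := hmin (a := z) ⟨by simpa using (hz'.trans_le hz0a').le, hc.le⟩
    simp only [Set.mem_ofPred_eq] at this
    linarith
  have hr : ‖z0‖ ≠ 0 := by simpa using hz0ne
  have hle : ∀ z, ‖z‖ ≤ ‖z0‖ → ‖w z‖ ≤ ρ := by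
    intro z hz
    have hcl : closure (ball (0:ℂ) ‖z0‖) = closedBall 0 ‖z0‖ := closure_ball _ hr
    have hs2 : closedBall (0:ℂ) ‖z0‖ ⊆ ball 0 1 := closedBall_subset_ball (by simpa using hz0)
    refine le_on_closure (f := fun z => ‖w z‖) (g := fun _ => ρ) hlt ?_ continuousOn_const ?_
    · rw [hcl]; exact (hd.continuousOn.mono hs2).norm
    · rw [hcl]; simpa using hz
  have hEq : ‖w z0‖ = ρ := le_antisymm (hle z0 le_rfl) hz0b
  obtain ⟨k, hk, hkw⟩ := jack w n hn hd hw0 hO z0 hz0 hz0ne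
    (by rw [← norm_pos_iff, hEq]; exact hρ) (by rw [hEq]; exact hle)
  have hF : f z0 ≠ 0 := hfne z0 hz0 hz0ne
  have hF' := hf'ne z0 hz0
  have hb := hbound z0 hz0 hz0ne
  have hdw : deriv w z0 = (deriv f z0 * (z0 * deriv f z0)
      - f z0 * (deriv f z0 + z0 * deriv (deriv f) z0)) / (z0 * deriv f z0) ^ 2 := by
    have he : w =ᶠ[nhds z0] fun z => f z / (z * deriv f z) - 1 := by
      filter_upwards [isOpen_ne.mem_nhds hz0ne] with z hz using hwz z hz
    rw [he.deriv_eq]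
    have h1 := (hfN z0 hz0).differentiableAt.hasDerivAt
    have h2 := (hfN z0 hz0).deriv.differentiableAt.hasDerivAt
    have := ((h1.div ((hasDerivAt_id z0).mul h2) (mul_ne_zero hz0ne hF')).sub_const 1).deriv
    simpa using this
  have h1w : 1 + w z0 ≠ 0 := by
    rw [hwz z0 hz0ne]; simp [hF, hF', hz0ne]
  have hE : β * (z0 * deriv f z0 / f z0 - 1) + γ * (z0 * deriv (deriv f) z0 / deriv f z0)
      = -((β + γ * (k + 1)) * w z0 / (1 + w z0)) := by
    have hA : -((β + γ * (k + 1)) * w z0 / (1 + w z0)) =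
      -(((β + γ) * w z0 + γ * (z0 * deriv w z0)) / (1 + w z0)) := by rw [hkw]; ring
    have hB : 1 + w z0 = f z0 / (z0 * deriv f z0) := by rw [hwz z0 hz0ne]; ring
    rw [hA, hB, hdw, hwz z0 hz0ne]
    field_simp
    ring
  rw [hE, norm_neg, norm_div, norm_mul, hEq] at hb
  have hn1 : ‖1 + w z0‖ ≤ 1 + ρ := by
    have := norm_add_le (1:ℂ) (w z0)
    simpa [hEq] using this
  have hn1p : 0 < ‖1 + w z0‖ := norm_pos_iff.2 h1w
  have hmono : ‖β + γ * ((n : ℂ) + 1)‖ ≤ ‖β + γ * ((k:ℂ) + 1)‖ := by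
    have e : ∀ x : ℂ, β + γ * x = γ * (β / γ + x) := by intro x; field_simp
    rw [e, e, norm_mul, norm_mul]
    gcongr ‖γ‖ * ?_
    rw [← sq_le_sq₀ (norm_nonneg _) (norm_nonneg _), ← Complex.normSq_eq_norm_sq,
      ← Complex.normSq_eq_norm_sq, Complex.normSq_apply, Complex.normSq_apply]
    simp
    nlinarith
  have : ρ / (1 + ρ) * ‖β + γ * ((n : ℂ) + 1)‖ ≤ ‖β + γ * ((k:ℂ) + 1)‖ * ρ / ‖1 + w z0‖ := by
    calc _ ≤ ρ / (1 + ρ) * ‖β + γ * ((k : ℂ) + 1)‖ := by gcongr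
      _ = ‖β + γ * ((k:ℂ) + 1)‖ * ρ / (1 + ρ) := by ring
      _ ≤ _ := by gcongr
  linarith
end

section
/- Let n ≥ 1 and let f ∈ A_n with f(z) ≠ 0 for all z ∈ U \ {0} and f'(z) ≠ 0 for all z ∈ U. Let 1/2 ≤ α < 1 be real and let β, γ be complex numbers with γ ≠ 0 and Re(β/γ) > −(n + 1). If |β·(z f'(z)/f(z) − 1) + γ·(z f''(z)/f'(z))| < (1 − α)|β + γ(n + 1)| for all z ∈ U, then |f(z)/(z f'(z)) − 1/(2α)| < 1/(2α) for all z ∈ U \ {0}; in particular f ∈ S*(α). -/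
open Complex Metric

lemma jack_dir (h : ℂ → ℂ) (z0 c : ℂ) (hd : DifferentiableAt ℂ h z0)
    (hmax : ∀ z, ‖z‖ ≤ ‖z0‖ → ‖h z‖ ≤ ‖h z0‖) (hne : h z0 ≠ 0) (hc : c.re ≤ 0) :
    (c * (z0 * deriv h z0 / h z0)).re ≤ 0 := by
  have h1 : HasDerivAt (fun t : ℂ => z0 * Complex.exp (c * t)) (z0 * c) 0 := by
    have := (((hasDerivAt_id (0:ℂ)).const_mul c).cexp).const_mul z0
    simpa using this
  have h2 : HasDerivAt (fun t : ℂ => h (z0 * Complex.exp (c * t)) / h z0)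
      (deriv h z0 * (z0 * c) / h z0) 0 := by
    have h3 : HasDerivAt h (deriv h z0) (z0 * Complex.exp (c * 0)) := by
      simpa using hd.hasDerivAt
    exact (h3.comp (0:ℂ) h1).div_const _
  have h4 := HasDerivAt.real_of_complex (z := 0)
    (e := fun t : ℂ => h (z0 * Complex.exp (c * t)) / h z0)
    (e' := deriv h z0 * (z0 * c) / h z0) (by rw [Complex.ofReal_zero]; exact h2)
  have h5 := (hasDerivAt_iff_tendsto_slope.1 h4).mono_left
    (nhdsWithin_mono _ (show Set.Ioi (0:ℝ) ⊆ {0}ᶜ from fun x hx => ne_of_gt hx))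
  have h6 := le_of_tendsto (b := 0) h5 (by
    filter_upwards [self_mem_nhdsWithin] with t ht
    rw [slope_def_field]
    have ht' : (0:ℝ) < t := ht
    apply div_nonpos_of_nonpos_of_nonneg _ (by simpa using ht'.le)
    have : ‖h (z0 * Complex.exp (c * t)) / h z0‖ ≤ 1 := by
      rw [norm_div]
      apply div_le_one_of_le₀ _ (norm_nonneg _)
      apply hmax
      rw [norm_mul, Complex.norm_exp]
      apply mul_le_of_le_one_right (norm_nonneg _)
      rw [Real.exp_le_one_iff]
      simp
      exact mul_nonpos_of_nonpos_of_nonneg hc ht'.le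
    have := (Complex.re_le_norm _).trans this
    simp [hne]
    simpa using this)
  have e : c * (z0 * deriv h z0 / h z0) = deriv h z0 * (z0 * c) / h z0 := by ring
  rw [e]
  exact h6

lemma jack_s7 (h : ℂ → ℂ) (z0 : ℂ) (hd : DifferentiableAt ℂ h z0)
    (hmax : ∀ z, ‖z‖ ≤ ‖z0‖ → ‖h z‖ ≤ ‖h z0‖) (hne : h z0 ≠ 0) :
    ∃ m : ℝ, 0 ≤ m ∧ z0 * deriv h z0 = m * h z0 := by
  have a1 := jack_dir h z0 I hd hmax hne (by simp)
  have a2 := jack_dir h z0 (-I) hd hmax hne (by simp)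
  have a3 := jack_dir h z0 (-1) hd hmax hne (by simp)
  set u := z0 * deriv h z0 / h z0 with hu
  simp only [Complex.mul_re, Complex.I_re, Complex.I_im, Complex.neg_re, Complex.neg_im,
    Complex.one_re, Complex.one_im] at a1 a2 a3
  refine ⟨u.re, by linarith, ?_⟩
  have : (u.re : ℂ) = u := by
    apply Complex.ext
    · simp
    · simp; linarith
  rw [this, hu]; field_simp

lemma factor (F : ℂ → ℂ) (m : ℕ) (hF : DifferentiableOn ℂ F (ball 0 1))
    (h0 : ∀ k < m, iteratedDeriv k F 0 = 0) :
    ∃ H : ℂ → ℂ, DifferentiableOn ℂ H (ball 0 1) ∧ ∀ z ∈ ball (0:ℂ) 1, F z = z ^ m * H z := by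
  have hA : AnalyticAt ℂ F 0 := hF.analyticAt (isOpen_ball.mem_nhds (by simp))
  obtain ⟨g, hg, hgF⟩ := (natCast_le_analyticOrderAt hA).1
    ((natCast_le_analyticOrderAt_iff_iteratedDeriv_eq_zero hA).2 h0)
  have hgF0 := hgF.self_of_nhds
  refine ⟨fun z => if z = 0 then g 0 else F z / z ^ m, ?_, ?_⟩
  · intro z hz
    apply DifferentiableAt.differentiableWithinAt
    by_cases hz0 : z = 0
    · subst hz0
      apply hg.differentiableAt.congr_of_eventuallyEq
      filter_upwards [hgF] with y hy
      by_cases hy0 : y = 0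
      · simp [hy0]
      · simp [hy0, hy]
    · have : DifferentiableAt ℂ (fun z => F z / z ^ m) z :=
        (hF.differentiableAt (isOpen_ball.mem_nhds hz)).div (by fun_prop) (pow_ne_zero _ hz0)
      apply this.congr_of_eventuallyEq
      filter_upwards [isOpen_ne.mem_nhds hz0] with y hy
      simp [show y ≠ 0 from hy]
  · intro z hz
    by_cases hz0 : z = 0
    · subst hz0; simpa using hgF0
    · have := pow_ne_zero m hz0
      simp only [hz0, if_false]; field_simp

lemma shift_norm (b : ℂ) (m : ℝ) (hm : 0 ≤ m) (hb : 0 ≤ b.re) : ‖b‖ ≤ ‖b + m‖ := by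
  apply le_of_sq_le_sq _ (norm_nonneg _)
  rw [Complex.sq_norm, Complex.sq_norm, normSq_apply, normSq_apply]
  simp; nlinarith

/-- **Theorem 2, case `1/2 ≤ α < 1`.**
If `f ∈ A_n`, nonvanishing on `U \ {0}` with nonvanishing derivative on `U`,
and for complex `β, γ` with `γ ≠ 0`, `Re(β/γ) > −(n + 1)` one has
`|β·(z f'(z)/f(z) − 1) + γ·(z f''(z)/f'(z))| < (1 − α)|β + γ(n + 1)|` on `U`,
then `|f(z)/(z f'(z)) − 1/(2α)| < 1/(2α)` on `U`; in particular
`f ∈ S*(α)`, i.e. `Re(z f'(z)/f(z)) > α` on `U`. -/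
theorem mocanu_thm2_starlike_large_alpha
    (n : ℕ) (hn : 1 ≤ n) (f : ℂ → ℂ)
    (hf : AnalyticOn ℂ f (ball (0 : ℂ) 1))
    (hf0 : f 0 = 0) (hf'0 : deriv f 0 = 1)
    (hcoef : ∀ k : ℕ, 2 ≤ k → k ≤ n → iteratedDeriv k f 0 = 0)
    (hfne : ∀ z ∈ ball (0 : ℂ) 1, z ≠ 0 → f z ≠ 0)
    (hf'ne : ∀ z ∈ ball (0 : ℂ) 1, deriv f z ≠ 0)
    (α : ℝ) (hα0 : 1 / 2 ≤ α) (hα : α < 1)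
    (β γ : ℂ) (hγ : γ ≠ 0)
    (hre : -((n : ℝ) + 1) < (β / γ).re)
    (hbound : ∀ z ∈ ball (0 : ℂ) 1, z ≠ 0 →
      ‖β * (z * deriv f z / f z - 1)
          + γ * (z * deriv (deriv f) z / deriv f z)‖
        < (1 - α) * ‖β + γ * ((n : ℂ) + 1)‖) :
    ∀ z ∈ ball (0 : ℂ) 1, z ≠ 0 →
      ‖f z / (z * deriv f z) - 1 / (2 * α)‖ < 1 / (2 * α) ∧
      α < (z * deriv f z / f z).re := by
  have hfd : DifferentiableOn ℂ f (ball 0 1) := hf.differentiableOn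
  have hf'd : DifferentiableOn ℂ (deriv f) (ball 0 1) := hfd.deriv isOpen_ball
  have hfA : AnalyticAt ℂ f 0 := hfd.analyticAt (isOpen_ball.mem_nhds (by simp))
  have hαp : 0 < α := by linarith
  obtain ⟨H, hH, hHf⟩ := factor (fun z => f z - z) (n+1) (hfd.sub differentiableOn_id) (by
    intro k hk
    have : iteratedDeriv k (fun z => f z - z) 0
        = iteratedDeriv k f 0 - iteratedDeriv k (fun z : ℂ => z) 0 :=
      iteratedDeriv_fun_sub hfA.contDiffAt contDiffAt_id
    rw [this]
    rcases k with _ | _ | k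
    · simp [hf0]
    · simp [iteratedDeriv_one, hf'0]
    · rw [hcoef _ (by omega) (by omega), iteratedDeriv_succ', iteratedDeriv_succ']
      simp)
  have hHd : DifferentiableOn ℂ (deriv H) (ball 0 1) := hH.deriv isOpen_ball
  have hder : ∀ z ∈ ball (0:ℂ) 1, deriv f z = 1 + (n+1) * z^n * H z + z^(n+1) * deriv H z := by
    intro z hz
    have e : f =ᶠ[nhds z] fun z => z + z^(n+1) * H z := by
      filter_upwards [isOpen_ball.mem_nhds hz] with y hy
      have := hHf y hy
      linear_combination this
    rw [e.deriv_eq]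
    have := (hasDerivAt_id z).add ((hasDerivAt_pow (n+1) z).mul
      (hH.differentiableAt (isOpen_ball.mem_nhds hz)).hasDerivAt)
    refine this.deriv.trans ?_
    simp; ring
  set h : ℂ → ℂ := fun z => (n * H z + z * deriv H z) / deriv f z with hh
  have hhd : DifferentiableOn ℂ h (ball 0 1) :=
    (((differentiableOn_const _).mul hH).add (differentiableOn_id.mul hHd)).div hf'd hf'ne
  have key : ∀ z ∈ ball (0:ℂ) 1, f z = z * deriv f z * (1 - z^n * h z) := by
    intro z hz
    have e1 : deriv f z * h z = n * H z + z * deriv H z := by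
      simp only [hh]; field_simp [hf'ne z hz]
    have e2 := hHf z hz
    have e3 := hder z hz
    linear_combination e2 - z * e3 + z^(n+1) * e1
  have key2 : ∀ z ∈ ball (0:ℂ) 1, deriv f z = (deriv f z + z * deriv (deriv f) z) * (1 - z^n * h z)
      - deriv f z * z^n * (n * h z + z * deriv h z) := by
    intro z hz
    have e : f =ᶠ[nhds z] fun z => z * deriv f z * (1 - z^n * h z) := by
      filter_upwards [isOpen_ball.mem_nhds hz] with y hy using key y hy
    have e1 := ((hasDerivAt_id z).mul (hf'd.differentiableAt (isOpen_ball.mem_nhds hz)).hasDerivAt).mul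
      (((hasDerivAt_pow n z).mul
      (hhd.differentiableAt (isOpen_ball.mem_nhds hz)).hasDerivAt).const_sub 1)
    have e2 := e.deriv_eq.trans e1.deriv
    simp only [id, Pi.mul_apply] at e2
    obtain ⟨k, rfl⟩ : ∃ k, n = k + 1 := ⟨n - 1, by omega⟩
    rw [add_tsub_cancel_right] at e2
    linear_combination e2
  have bnd : ∀ z ∈ ball (0:ℂ) 1, z ≠ 0 → ‖z^n * h z‖ < (1 - α) / α := by
    intro z hz hz0
    have hz1 : ‖z‖ < 1 := by simpa using hz
    have hzp : 0 < ‖z‖ := norm_pos_iff.2 hz0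
    have hsub : closedBall (0:ℂ) ‖z‖ ⊆ ball 0 1 := closedBall_subset_ball hz1
    obtain ⟨z0, hz0f, hmax⟩ := Complex.exists_mem_frontier_isMaxOn_norm (f := h)
      (isBounded_ball (x := (0:ℂ)) (r := ‖z‖)) ⟨0, by simpa using hz0⟩
      (by
        apply DifferentiableOn.diffContOnCl
        rw [closure_ball _ hzp.ne']
        exact hhd.mono hsub)
    rw [closure_ball _ hzp.ne'] at hmax
    rw [frontier_ball _ hzp.ne'] at hz0f
    have hn0 : ‖z0‖ = ‖z‖ := by simpa using hz0f
    have hz00 : z0 ≠ 0 := by rw [← norm_pos_iff, hn0]; exact hzp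
    have hz0b : z0 ∈ ball (0:ℂ) 1 := by simpa [hn0] using hz1
    have hm : ∀ y, ‖y‖ ≤ ‖z0‖ → ‖h y‖ ≤ ‖h z0‖ := by
      intro y hy
      exact hmax (show y ∈ closedBall (0:ℂ) ‖z‖ by simpa [← hn0] using hy)
    have hle : ‖z^n * h z‖ ≤ ‖z0^n * h z0‖ := by
      rw [norm_mul, norm_mul, norm_pow, norm_pow, hn0]
      exact mul_le_mul_of_nonneg_left (hm z hn0.ge) (by positivity)
    refine hle.trans_lt ?_
    by_cases hne : h z0 = 0
    · rw [hne]; simp; exact div_pos (by linarith) hαp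
    obtain ⟨m, hm0, hjm⟩ := jack_s7 h z0 (hhd.differentiableAt (isOpen_ball.mem_nhds hz0b)) hm hne
    have k1 := key z0 hz0b
    have k2 := key2 z0 hz0b
    have hb := hbound z0 hz0b hz00
    have d0 := hf'ne z0 hz0b
    have f0 := hfne z0 hz0b hz00
    rw [hjm] at k2
    set w := z0^n * h z0 with hw
    have w1 : 1 - w ≠ 0 := by
      intro h'; rw [h'] at k1; simp at k1; exact f0 k1
    have k3 : z0 * deriv (deriv f) z0 = deriv f z0 * (w * (1 + n + m)) / (1 - w) := by
      rw [eq_div_iff w1]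
      linear_combination -k2 - deriv f z0 * (n + m) * hw
    have k4 : β * (z0 * deriv f z0 / f z0 - 1)
          + γ * (z0 * deriv (deriv f) z0 / deriv f z0)
          = γ * (β / γ + (n + 1) + m) * (w / (1 - w)) := by
      rw [k3, k1]; field_simp; ring
    have k5 : β + γ * ((n : ℂ) + 1) = γ * (β / γ + (n + 1)) := by field_simp
    rw [k4, k5, norm_mul, norm_mul, norm_mul, norm_div] at hb
    set B := β / γ + ((n:ℂ) + 1) with hB
    have hBre : 0 < B.re := by simp [hB]; simp at hre; linarith
    have hBn : 0 < ‖B‖ := hBre.trans_le (Complex.re_le_norm _)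
    have hs := shift_norm B m hm0 hBre.le
    have hγp : 0 < ‖γ‖ := norm_pos_iff.2 hγ
    have c1 : ‖γ‖ * ‖B‖ * (‖w‖ / ‖1 - w‖) < ‖γ‖ * ‖B‖ * (1 - α) := by
      calc _ ≤ ‖γ‖ * ‖B + m‖ * (‖w‖ / ‖1 - w‖) := by gcongr
        _ < _ := hb
        _ = _ := by ring
    have c2 := lt_of_mul_lt_mul_left c1 (by positivity)
    rw [div_lt_iff₀ (norm_pos_iff.2 w1)] at c2
    have c3 : ‖1 - w‖ ≤ 1 + ‖w‖ := by simpa using norm_sub_le 1 w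
    rw [lt_div_iff₀ hαp]
    nlinarith
  intro z hz hz0
  have d0 := hf'ne z hz
  have f0 := hfne z hz hz0
  have hb := bnd z hz hz0
  have hq : f z / (z * deriv f z) = 1 - z^n * h z := by
    rw [div_eq_iff (mul_ne_zero hz0 d0)]; linear_combination key z hz
  have first : ‖f z / (z * deriv f z) - 1 / (2 * α)‖ < 1 / (2 * α) := by
    rw [hq]
    have e : (1:ℂ) - z^n * h z - 1 / (2 * α) = ((1 - 1/(2*α) : ℝ) : ℂ) - z^n * h z := by
      push_cast; ring
    rw [e]
    have hnn : 0 ≤ 1 - 1/(2*α) := by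
      rw [sub_nonneg, div_le_one (by positivity)]; linarith
    have := norm_sub_le ((1 - 1/(2*α) : ℝ) : ℂ) (z^n * h z)
    rw [Complex.norm_real, Real.norm_of_nonneg hnn] at this
    have e2 : (1 - α) / α = 2 * (1/(2*α)) - 1 := by field_simp
    linarith
  refine ⟨first, ?_⟩
  set p := z * deriv f z / f z with hp
  have hpne : p ≠ 0 := div_ne_zero (mul_ne_zero hz0 d0) f0
  have hαc : (α:ℂ) ≠ 0 := by exact_mod_cast hαp.ne'
  have e : f z / (z * deriv f z) - 1 / (2 * α) = (2 * α - p) / p * (1 / (2*α) : ℝ) := by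
    have : f z / (z * deriv f z) = 1 / p := by rw [hp]; field_simp
    rw [this]; push_cast; field_simp
  rw [e, norm_mul, Complex.norm_real, Real.norm_of_nonneg (by positivity), norm_div] at first
  have g1 : ‖2 * α - p‖ / ‖p‖ < 1 := by
    have : 0 < 1 / (2*α) := by positivity
    by_contra hcon
    push Not at hcon
    nlinarith
  rw [div_lt_one (norm_pos_iff.2 hpne)] at g1
  have g2 : ‖2 * α - p‖^2 < ‖p‖^2 := by gcongr
  rw [Complex.sq_norm, Complex.sq_norm, normSq_apply, normSq_apply] at g2
  simp at g2
  nlinarith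
end
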